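/- arXiv:2408.13932 — 8 statements merged into one kernel-verified Lean document; each statement's English description precedes it below -/
import Mathlib

section
/- Let q be an odd prime and m ≥ 2 an integer. Fix d ∈ (ZMod (q^m))ˣ whose image in ZMod q is not a square, let u ∈ (ZMod (q^m))ˣ, let χ be a primitive Dirichlet character modulo q^m, and let λ : Rˣ → ℂˣ be admissible of conductor q^m. Write each x ∈ R uniquely as x = α + β·(u·θ) with α, β ∈ ZMod (q^m), and set τ(x) = β. Then Σ_{x ∈ Rˣ} (λ·χ_K)⁻¹(x) · e_m(τ(x)) = G(χ⁻²) · Σ_{a ∈ ZMod (q^m)} λ⁻¹(a + u·θ) · χ⁻¹(a² − d·u²). -/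
open Polynomial

/-- The standard additive character `x ↦ exp(2πi·x.val/n)` on `ZMod n`. -/
noncomputable def stdAddChar' (n : ℕ) (x : ZMod n) : ℂ :=
  Complex.exp (2 * Real.pi * Complex.I * x.val / n)

/-- The Gauss sum of a Dirichlet character modulo `n`. -/
noncomputable def gaussS (n : ℕ) [NeZero n] (χ : DirichletCharacter ℂ n) : ℂ :=
  ∑ a : ZMod n, χ a * stdAddChar' n a

/-- A Dirichlet character modulo `q^m` is primitive iff it is nontrivial on the
subgroup of units congruent to `1` modulo `q^(m-1)`. -/
def IsPrim (q m : ℕ) (χ : DirichletCharacter ℂ (q ^ m)) : Prop :=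
  ∃ u : (ZMod (q ^ m))ˣ,
    ZMod.castHom (pow_dvd_pow q (Nat.sub_le m 1)) (ZMod (q ^ (m - 1))) (u : ZMod (q ^ m)) = 1 ∧
    χ (u : ZMod (q ^ m)) ≠ 1

/-- The ring `R = (ZMod n)[θ] = (ZMod n)[X]/(X² - d)`. -/
abbrev Rring (n : ℕ) (d : ZMod n) : Type := AdjoinRoot (X ^ 2 - C d)

/-- `χ_K : Rˣ →* ℂˣ`, `x ↦ χ(Nm x)`. -/
noncomputable def chiK (n : ℕ) (d : ZMod n) (χ : DirichletCharacter ℂ n) :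
    (Rring n d)ˣ →* ℂˣ :=
  χ.toUnitHom.comp (Units.map (Algebra.norm (ZMod n) (S := Rring n d)))

/-- `G_R(μ) = Σ_{x ∈ Rˣ} μ(x)·e_m(tr x)`. -/
noncomputable def GR (n : ℕ) (d : ZMod n) (μ : (Rring n d)ˣ →* ℂˣ) : ℂ :=
  ∑ᶠ x : (Rring n d)ˣ,
    (μ x : ℂ) * stdAddChar' n (Algebra.trace (ZMod n) (Rring n d) (x : Rring n d))

/-- `λ : Rˣ →* ℂˣ` is admissible of conductor `q^m`: trivial on the image of
`(ZMod (q^m))ˣ` in `Rˣ` and nontrivial on the subgroup `1 + q^(m-1)·R` of `Rˣ`. -/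
def Admissible (q m : ℕ) (d : ZMod (q ^ m)) (lam : (Rring (q ^ m) d)ˣ →* ℂˣ) : Prop :=
  (∀ t : (ZMod (q ^ m))ˣ,
    lam (Units.map (AdjoinRoot.of (X ^ 2 - C d)).toMonoidHom t) = 1) ∧
  ∃ x : (Rring (q ^ m) d)ˣ,
    (∃ r : Rring (q ^ m) d, (x : Rring (q ^ m) d) = 1 + (q ^ (m - 1) : ℕ) * r) ∧ lam x ≠ 1


lemma aux_monic (n : ℕ) (d : ZMod n) : (X ^ 2 - C d : (ZMod n)[X]).Monic :=
  monic_X_pow_sub_C d two_ne_zero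

lemma aux_natDegree (n : ℕ) [Fact (1 < n)] (d : ZMod n) : (X ^ 2 - C d : (ZMod n)[X]).natDegree = 2 :=
  natDegree_X_pow_sub_C

lemma aux_root (n : ℕ) (d : ZMod n) :
    (AdjoinRoot.root (X ^ 2 - C d)) * (AdjoinRoot.root (X ^ 2 - C d)) = AdjoinRoot.of (X ^ 2 - C d) d := by
  have := AdjoinRoot.eval₂_root (X ^ 2 - C d : (ZMod n)[X])
  simp only [eval₂_sub, eval₂_X_pow, eval₂_C] at this
  rw [← pow_two]; exact sub_eq_zero.mp this

noncomputable def auxB (n : ℕ) [Fact (1 < n)] (d : ZMod n) : Module.Basis (Fin 2) (ZMod n) (Rring n d) :=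
  (AdjoinRoot.powerBasis' (aux_monic n d)).basis.reindex (finCongr (aux_natDegree n d))

lemma auxB0 (n : ℕ) [Fact (1 < n)] (d : ZMod n) : auxB n d 0 = 1 := by
  rw [auxB, Module.Basis.reindex_apply, PowerBasis.basis_eq_pow]
  exact pow_zero _

lemma auxB1 (n : ℕ) [Fact (1 < n)] (d : ZMod n) : auxB n d 1 = AdjoinRoot.root (X ^ 2 - C d) := by
  rw [auxB, Module.Basis.reindex_apply, PowerBasis.basis_eq_pow, AdjoinRoot.powerBasis'_gen]
  exact pow_one _

lemma aux_norm (n : ℕ) [Fact (1 < n)] (d : ZMod n) (a b : ZMod n) :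
    Algebra.norm (ZMod n) (AdjoinRoot.of (X ^ 2 - C d) a + AdjoinRoot.of (X ^ 2 - C d) b * AdjoinRoot.root (X ^ 2 - C d))
     = a ^ 2 - d * b ^ 2 := by
  have h0 : (AdjoinRoot.of (X ^ 2 - C d) a + AdjoinRoot.of (X ^ 2 - C d) b * AdjoinRoot.root (X ^ 2 - C d)) * auxB n d 0
    = a • auxB n d 0 + b • auxB n d 1 := by
    rw [auxB0, auxB1, Algebra.smul_def, Algebra.smul_def, AdjoinRoot.algebraMap_eq]; ring
  have h1 : (AdjoinRoot.of (X ^ 2 - C d) a + AdjoinRoot.of (X ^ 2 - C d) b * AdjoinRoot.root (X ^ 2 - C d)) * auxB n d 1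
    = (d * b) • auxB n d 0 + a • auxB n d 1 := by
    rw [auxB0, auxB1, Algebra.smul_def, Algebra.smul_def, AdjoinRoot.algebraMap_eq, map_mul, ← aux_root]; ring
  rw [Algebra.norm_eq_matrix_det (auxB n d), Matrix.det_fin_two]
  simp only [Algebra.leftMulMatrix_eq_repr_mul, h0, h1]
  simp
  ring

lemma aux_repr (n : ℕ) [Fact (1 < n)] (d : ZMod n) (x : Rring n d) :
    ∃ a b, x = AdjoinRoot.of (X ^ 2 - C d) a + AdjoinRoot.of (X ^ 2 - C d) b * AdjoinRoot.root (X ^ 2 - C d) := by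
  refine ⟨(auxB n d).repr x 0, (auxB n d).repr x 1, ?_⟩
  conv_lhs => rw [← (auxB n d).sum_repr x]
  rw [Fin.sum_univ_two, auxB0, auxB1, Algebra.smul_def, Algebra.smul_def, AdjoinRoot.algebraMap_eq]; ring

lemma aux_finite (n : ℕ) [Fact (1 < n)] (d : ZMod n) : Finite (Rring n d) := by
  haveI : NeZero n := ⟨by have := Fact.out (p := 1 < n); omega⟩
  exact Finite.of_equiv _ (auxB n d).equivFun.toEquiv.symm

lemma aux_cast (q m : ℕ) [Fact q.Prime] (hm : 2 ≤ m) (v : ZMod (q ^ m))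
    (hv : ZMod.castHom (pow_dvd_pow q (Nat.sub_le m 1)) (ZMod (q ^ (m - 1))) v = 1) :
    ∃ k : ZMod (q ^ m), v = 1 + (q : ZMod (q ^ m)) ^ (m - 1) * k := by
  haveI : NeZero (q ^ m) := ⟨pow_ne_zero _ (Fact.out (p := q.Prime)).ne_zero⟩
  haveI : NeZero (q ^ (m - 1)) := ⟨pow_ne_zero _ (Fact.out (p := q.Prime)).ne_zero⟩
  have h : (((v.val : ℤ) - 1 : ℤ) : ZMod (q ^ (m - 1))) = 0 := by
    rw [← ZMod.natCast_zmod_val v, map_natCast] at hv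
    push_cast
    rw [hv, sub_self]
  rw [ZMod.intCast_zmod_eq_zero_iff_dvd] at h
  obtain ⟨k, hk⟩ := h
  refine ⟨k, ?_⟩
  have := congrArg (fun z : ℤ => (z : ZMod (q ^ m))) hk
  push_cast at this
  rw [ZMod.natCast_zmod_val] at this
  rw [← this]; ring

lemma aux_q (q m : ℕ) (hm : 2 ≤ m) : (q : ZMod (q ^ m)) ^ (m - 1) * q = 0 := by
  rw [← pow_succ, Nat.sub_add_cancel (by omega)]
  exact_mod_cast ZMod.natCast_self (q ^ m)

lemma aux_nonunit (q m : ℕ) [hq : Fact q.Prime] (hm : 2 ≤ m) (b : ZMod (q ^ m)) (hb : ¬ IsUnit b) :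
    ∃ k, b = q * k := by
  haveI : NeZero (q ^ m) := ⟨pow_ne_zero _ hq.out.ne_zero⟩
  rw [← ZMod.natCast_zmod_val b, ZMod.isUnit_iff_coprime, Nat.coprime_pow_right_iff (by omega), Nat.coprime_comm, hq.out.coprime_iff_not_dvd, not_not] at hb
  obtain ⟨k, hk⟩ := hb
  exact ⟨k, by rw [← ZMod.natCast_zmod_val b, hk]; push_cast; rfl⟩

lemma aux_pow (q m : ℕ) [hq : Fact q.Prime] (hm : 2 ≤ m) (k : ZMod (q ^ m)) :
    (1 + (q : ZMod (q ^ m)) ^ (m - 1) * k) ^ q = 1 := by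
  have hsq : ((q : ZMod (q ^ m)) ^ (m - 1) * k) ^ 2 = 0 := by
    obtain ⟨j, rfl⟩ : ∃ j, m = j + 2 := ⟨m - 2, by omega⟩
    have := aux_q q (j+2) hm
    calc _ = ((q : ZMod (q ^ (j+2))) ^ (j + 2 - 1) * q) * (q ^ j * k ^ 2) := by
          rw [show j + 2 - 1 = j + 1 by omega]; ring
      _ = 0 := by rw [this, zero_mul]
  have key : ∀ (N : ℕ) , (1 + (q : ZMod (q ^ m)) ^ (m - 1) * k) ^ N = 1 + N * (q ^ (m - 1) * k) := by
    intro N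
    induction N with
    | zero => simp
    | succ N ih => rw [pow_succ, ih]; push_cast; linear_combination (N : ZMod (q ^ m)) * hsq
  rw [key]
  linear_combination k * aux_q q m hm

theorem stmt2 (q m : ℕ) [Fact q.Prime] (hq : Odd q) (hm : 2 ≤ m)
    (d u : (ZMod (q ^ m))ˣ)
    (hd : ¬ ∃ y : ZMod q,
      y ^ 2 = ZMod.castHom (dvd_pow_self q (by omega : m ≠ 0)) (ZMod q) (d : ZMod (q ^ m)))
    (χ : DirichletCharacter ℂ (q ^ m)) (hχ : IsPrim q m χ)
    (lam : (Rring (q ^ m) (d : ZMod (q ^ m)))ˣ →* ℂˣ)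
    (hlam : Admissible q m (d : ZMod (q ^ m)) lam)
    -- `τ` gives the second coordinate with respect to the basis `{1, u·θ}` of `R`
    (τ : Rring (q ^ m) (d : ZMod (q ^ m)) → ZMod (q ^ m))
    (hτ : ∀ α β : ZMod (q ^ m),
      τ (AdjoinRoot.of _ α +
          AdjoinRoot.of _ β * (AdjoinRoot.of _ (u : ZMod (q ^ m)) * AdjoinRoot.root _)) = β)
    -- `w a` is the unit `a + u·θ` of `R`
    (w : ZMod (q ^ m) → (Rring (q ^ m) (d : ZMod (q ^ m)))ˣ)
    (hw : ∀ a : ZMod (q ^ m), (w a : Rring (q ^ m) (d : ZMod (q ^ m))) =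
      AdjoinRoot.of _ a + AdjoinRoot.of _ (u : ZMod (q ^ m)) * AdjoinRoot.root _) :
    (∑ᶠ x : (Rring (q ^ m) (d : ZMod (q ^ m)))ˣ,
        (((lam * chiK (q ^ m) (d : ZMod (q ^ m)) χ)⁻¹ x : ℂˣ) : ℂ) *
          stdAddChar' (q ^ m) (τ (x : Rring (q ^ m) (d : ZMod (q ^ m))))) =
      gaussS (q ^ m) ((χ ^ 2)⁻¹) *
        ∑ a : ZMod (q ^ m), ((lam⁻¹ (w a) : ℂˣ) : ℂ) *
          χ⁻¹ (a ^ 2 - (d : ZMod (q ^ m)) * (u : ZMod (q ^ m)) ^ 2) := by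
  classical
  have hqp : q.Prime := Fact.out
  haveI : Fact (1 < q ^ m) := ⟨Nat.one_lt_pow (by omega) hqp.one_lt⟩
  haveI := aux_finite (q ^ m) (d : ZMod (q ^ m))
  haveI : Fintype (Rring (q ^ m) (d : ZMod (q ^ m)))ˣ := Fintype.ofFinite _
  rw [finsum_eq_sum_of_fintype]
  set ι : (ZMod (q ^ m))ˣ →* (Rring (q ^ m) (d : ZMod (q ^ m)))ˣ :=
    Units.map (AdjoinRoot.of (X ^ 2 - C (d : ZMod (q ^ m)))).toMonoidHom with hι
  have hιv : ∀ t : (ZMod (q ^ m))ˣ, ((ι t : (Rring (q ^ m) (d : ZMod (q ^ m)))ˣ) : Rring (q ^ m) (d : ZMod (q ^ m))) = AdjoinRoot.of _ (t : ZMod (q ^ m)) := fun t => rfl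
  have hl1 : ∀ t, lam (ι t) = 1 := hlam.1
  have hroot := aux_root (q ^ m) (d : ZMod (q ^ m))
  -- norm of scalars
  have hK : ∀ t, chiK (q ^ m) (d : ZMod (q ^ m)) χ (ι t) = χ.toUnitHom t ^ 2 := by
    intro t
    have : Units.map (Algebra.norm (ZMod (q ^ m)) (S := Rring (q ^ m) (d : ZMod (q ^ m)))) (ι t) = t ^ 2 := by
      ext
      have := aux_norm (q ^ m) (d : ZMod (q ^ m)) t 0
      rw [Units.coe_map, hιv]
      simpa using this
    rw [chiK, MonoidHom.comp_apply, this, map_pow]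
  have hKw : ∀ a, ((chiK (q ^ m) (d : ZMod (q ^ m)) χ (w a) : ℂˣ) : ℂ) = χ (a ^ 2 - d * u ^ 2) := by
    intro a
    rw [chiK, MonoidHom.comp_apply, MulChar.coe_toUnitHom, Units.coe_map, hw]
    congr 1
    exact aux_norm _ _ _ _
  have hrep : ∀ x : Rring (q ^ m) (d : ZMod (q ^ m)), ∃ α, x = AdjoinRoot.of _ α +
      AdjoinRoot.of _ (τ x) * (AdjoinRoot.of _ (u : ZMod (q ^ m)) * AdjoinRoot.root _) := by
    intro x
    obtain ⟨a, b, hx⟩ := aux_repr _ _ x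
    have hx' : x = AdjoinRoot.of _ a +
      AdjoinRoot.of _ (b * (u⁻¹ : (ZMod (q ^ m))ˣ)) * (AdjoinRoot.of _ (u : ZMod (q ^ m)) * AdjoinRoot.root _) := by
      rw [← mul_assoc, ← map_mul, mul_assoc, Units.inv_mul, mul_one]; exact hx
    refine ⟨a, ?_⟩
    have : τ x = b * (u⁻¹ : (ZMod (q ^ m))ˣ) := by
      conv_lhs => rw [hx']
      exact hτ _ _
    rw [this]; exact hx'
  have hτs : ∀ (t : ZMod (q ^ m)) (x : Rring (q ^ m) (d : ZMod (q ^ m))), τ (AdjoinRoot.of _ t * x) = t * τ x := by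
    intro t x
    obtain ⟨α, hα⟩ := hrep x
    conv_lhs => rw [hα]
    rw [← hτ (t * α) (t * τ x)]
    congr 1
    rw [map_mul, map_mul]; ring
  have hτw : ∀ a, τ (w a) = 1 := by
    intro a
    rw [hw, ← hτ a 1, map_one, one_mul]
  have hτw2 : ∀ a, τ (AdjoinRoot.of (X ^ 2 - C (d : ZMod (q ^ m))) (u : ZMod (q ^ m)) * AdjoinRoot.root (X ^ 2 - C (d : ZMod (q ^ m))) * (w a : Rring (q ^ m) (d : ZMod (q ^ m)))) = a := by
    intro a
    rw [hw]
    conv_rhs => rw [← hτ (u ^ 2 * d) a]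
    congr 1
    rw [map_mul, map_pow, ← hroot]; ring
  set f : (Rring (q ^ m) (d : ZMod (q ^ m)))ˣ → ℂ := fun x =>
    (((lam * chiK (q ^ m) (d : ZMod (q ^ m)) χ)⁻¹ x : ℂˣ) : ℂ) *
          stdAddChar' (q ^ m) (τ (x : Rring (q ^ m) (d : ZMod (q ^ m)))) with hf
  have hmul : ∀ t x, (((lam * chiK (q ^ m) (d : ZMod (q ^ m)) χ)⁻¹ (ι t * x) : ℂˣ) : ℂ) =
      ((χ ^ 2)⁻¹ : DirichletCharacter ℂ (q ^ m)) t * (((lam * chiK (q ^ m) (d : ZMod (q ^ m)) χ)⁻¹ x : ℂˣ) : ℂ) := by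
    intro t x
    have h2 : ((χ ^ 2)⁻¹ : DirichletCharacter ℂ (q ^ m)) t = (((χ.toUnitHom t ^ 2)⁻¹ : ℂˣ) : ℂ) := by
      rw [MulChar.inv_apply_eq_inv', MulChar.pow_apply_coe, Units.val_inv_eq_inv_val, Units.val_pow_eq_pow_val, MulChar.coe_toUnitHom]
    rw [map_mul, Units.val_mul, h2]
    congr 2
    rw [MonoidHom.inv_apply, MonoidHom.mul_apply, hl1, hK, one_mul]
  change ∑ x, f x = _
  rw [← Finset.sum_filter_add_sum_filter_not Finset.univ (fun x : (Rring (q ^ m) (d : ZMod (q ^ m)))ˣ => IsUnit (τ x)) f]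
  have hzero : ∑ x with ¬ IsUnit (τ ((x : (Rring (q ^ m) (d : ZMod (q ^ m)))ˣ) : Rring (q ^ m) (d : ZMod (q ^ m)))), f x = 0 := by
    obtain ⟨v, hv1, hv2⟩ := hχ
    obtain ⟨k, hk⟩ := aux_cast q m hm _ hv1
    have hvq : χ (v : ZMod (q ^ m)) ^ q = 1 := by
      rw [← map_pow, hk, aux_pow q m hm, map_one]
    have hv3 : ((χ ^ 2)⁻¹ : DirichletCharacter ℂ (q ^ m)) v ≠ 1 := by
      rw [MulChar.inv_apply_eq_inv', MulChar.pow_apply_coe]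
      intro h
      rw [inv_eq_one] at h
      obtain ⟨j, rfl⟩ := hq
      rw [pow_succ, pow_mul, h, one_pow, one_mul] at hvq
      exact hv2 hvq
    have hvτ : ∀ b : ZMod (q ^ m), ¬ IsUnit b → v * b = b := by
      intro b hb
      obtain ⟨c, rfl⟩ := aux_nonunit q m hm b hb
      rw [hk]
      linear_combination k * c * aux_q q m hm
    set S := ∑ x with ¬ IsUnit (τ ((x : (Rring (q ^ m) (d : ZMod (q ^ m)))ˣ) : Rring (q ^ m) (d : ZMod (q ^ m)))), f x with hS
    have hSS : ((χ ^ 2)⁻¹ : DirichletCharacter ℂ (q ^ m)) v * S = S := by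
      conv_rhs => rw [hS]
      rw [hS, Finset.mul_sum]
      refine Finset.sum_equiv (Equiv.mulLeft (ι v)) ?_ ?_
      · intro x
        simp only [Finset.mem_filter, Finset.mem_univ, true_and, Equiv.coe_mulLeft, Units.val_mul, hιv, hτs, IsUnit.mul_iff, Units.isUnit]
      · intro x hx
        rw [Finset.mem_filter] at hx
        simp only [Equiv.coe_mulLeft, hf]
        rw [hmul, Units.val_mul, hιv, hτs, hvτ _ hx.2, mul_assoc]
    have : (((χ ^ 2)⁻¹ : DirichletCharacter ℂ (q ^ m)) v - 1) * S = 0 := by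
      rw [sub_mul, hSS, one_mul, sub_self]
    exact (mul_eq_zero.mp this).resolve_left (sub_ne_zero.mpr hv3)
  rw [hzero, add_zero]
  have hG : gaussS (q ^ m) ((χ ^ 2)⁻¹) = ∑ t : (ZMod (q ^ m))ˣ, ((χ ^ 2)⁻¹ : DirichletCharacter ℂ (q ^ m)) t * stdAddChar' (q ^ m) t := by
    rw [gaussS]
    symm
    refine Finset.sum_of_injOn (fun t : (ZMod (q ^ m))ˣ => (t : ZMod (q ^ m))) (fun _ _ _ _ h => Units.ext h) (fun _ _ => by simp) ?_ (fun _ _ => rfl)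
    intro b _ hb
    rw [MulChar.map_nonunit, zero_mul]
    rintro ⟨t, rfl⟩
    exact hb ⟨t, by simp, rfl⟩
  rw [hG, Finset.sum_mul_sum, ← Finset.sum_product']
  symm
  refine Finset.sum_bij (fun p _ => ι p.1 * w p.2) ?_ ?_ ?_ ?_
  · rintro ⟨t, a⟩ _
    simp [hιv, hτs, hτw]
  · rintro ⟨t, a⟩ _ ⟨s, b⟩ _ h
    have h1 := congrArg (fun x : (Rring (q ^ m) (d : ZMod (q ^ m)))ˣ => τ x) h
    simp only [Units.val_mul, hιv, hτs, hτw, mul_one] at h1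
    have h1' := Units.ext h1
    subst h1'
    have h2 := congrArg (fun x : (Rring (q ^ m) (d : ZMod (q ^ m)))ˣ => τ (AdjoinRoot.of (X ^ 2 - C (d : ZMod (q ^ m))) (u : ZMod (q ^ m)) * AdjoinRoot.root (X ^ 2 - C (d : ZMod (q ^ m))) * (x : Rring (q ^ m) (d : ZMod (q ^ m))))) (mul_left_cancel h)
    simp only [hτw2] at h2
    rw [h2]
  · intro x hx
    rw [Finset.mem_filter] at hx
    obtain ⟨t, ht⟩ := hx.2
    obtain ⟨α, hα⟩ := hrep x
    refine ⟨(t, α * (t⁻¹ : (ZMod (q ^ m))ˣ)), by simp, ?_⟩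
    apply Units.ext
    rw [Units.val_mul, hιv, hw, hα, ← ht, mul_add, ← map_mul, mul_left_comm, Units.mul_inv, mul_one]
  · rintro ⟨t, a⟩ _
    simp only [hf]
    rw [hmul, Units.val_mul, hιv, hτs, hτw, mul_one]
    have : (((lam * chiK (q ^ m) (d : ZMod (q ^ m)) χ)⁻¹ (w a) : ℂˣ) : ℂ) = ((lam⁻¹ (w a) : ℂˣ) : ℂ) *
          χ⁻¹ (a ^ 2 - (d : ZMod (q ^ m)) * (u : ZMod (q ^ m)) ^ 2) := by
      rw [MulChar.inv_apply_eq_inv', ← hKw, ← Units.val_inv_eq_inv_val, ← Units.val_mul,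
        MonoidHom.inv_apply, MonoidHom.inv_apply, MonoidHom.mul_apply, mul_inv]
    rw [this]; ring
end

section
/- Let q be an odd prime and m ≥ 2 an even integer. Let e ∈ (ZMod (q^m))ˣ be a unit whose image in ZMod q is not a square, and let a₀ ∈ (ZMod (q^m))ˣ satisfy a₀² = e − 1. For a ∈ ZMod (q^m) (so that a² − e is a unit), set F(a) = Σ over all primitive Dirichlet characters χ modulo q^m of χ(−4)·J(χ,χ)·χ⁻¹(a² − e). Then: F(a) = q^(3m/2 − 2)·(q−1)² if a = a₀ or a = −a₀; F(a) = −q^(3m/2 − 2)·(q−1) if a = a₀·(1 + q^(m−1)·u) or a = −a₀·(1 + q^(m−1)·u) for some integer u with 1 ≤ u ≤ q−1; and F(a) = 0 in all other cases. -/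
/-- The Jacobi sum `J(χ,ψ)`. -/
noncomputable def jacobiS (n : ℕ) [NeZero n] (χ ψ : DirichletCharacter ℂ n) : ℂ :=
  ∑ x : ZMod n, χ x * ψ (1 - x)

section helpers

variable {q m : ℕ} [Fact q.Prime]

lemma aux_dvd_lift (k : ℕ) (hk : k ≤ m) (n : ℕ) :
    (q : ZMod (q ^ m)) ^ k ∣ (n : ZMod (q ^ m)) ↔ q ^ k ∣ n := by
  constructor
  · rintro ⟨c, hc⟩
    have h := congrArg (ZMod.castHom (pow_dvd_pow q hk) (ZMod (q ^ k))) hc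
    rw [map_natCast, map_mul, map_pow, map_natCast, ← Nat.cast_pow, ZMod.natCast_self, zero_mul] at h
    exact (ZMod.natCast_eq_zero_iff _ _).1 h
  · rintro ⟨c, rfl⟩
    exact ⟨c, by push_cast; rfl⟩

lemma aux_nat (x : ZMod (q ^ m)) : ∃ n : ℕ, n < q ^ m ∧ (n : ZMod (q ^ m)) = x := by
  haveI : NeZero (q ^ m) := ⟨pow_ne_zero _ (Fact.out : q.Prime).ne_zero⟩
  exact ⟨x.val, ZMod.val_lt x, ZMod.natCast_zmod_val x⟩

lemma aux_qpow : (q : ZMod (q ^ m)) ^ m = 0 := by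
  rw [← Nat.cast_pow, ZMod.natCast_self]

lemma aux_qpow_ge {k : ℕ} (hk : m ≤ k) : (q : ZMod (q ^ m)) ^ k = 0 :=
  pow_eq_zero_of_le hk aux_qpow

lemma aux_unit (hm : 1 ≤ m) (x : ZMod (q ^ m)) : IsUnit x ↔ ¬ (q : ZMod (q ^ m)) ∣ x := by
  obtain ⟨n, -, rfl⟩ := aux_nat x
  have h := aux_dvd_lift (q := q) (m := m) 1 hm n
  rw [pow_one, pow_one] at h
  rw [h, ZMod.isUnit_iff_coprime, Nat.coprime_pow_right_iff (by omega), Nat.coprime_comm,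
    Nat.Prime.coprime_iff_not_dvd Fact.out]

lemma aux_struct (hm : 1 ≤ m) (x : ZMod (q ^ m)) (hx : x ≠ 0) :
    ∃ v, v < m ∧ ∃ u : (ZMod (q ^ m))ˣ, x = (q : ZMod (q ^ m)) ^ v * u := by
  obtain ⟨n, hn, rfl⟩ := aux_nat x
  have hn0 : n ≠ 0 := by rintro rfl; simp at hx
  obtain ⟨v, k, hk, rfl⟩ := Nat.exists_eq_pow_mul_and_not_dvd hn0 q (Fact.out : q.Prime).ne_one
  refine ⟨v, ?_, ?_⟩
  · by_contra h
    apply hx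
    push_cast
    rw [aux_qpow_ge (by omega), zero_mul]
  · have : IsUnit (k : ZMod (q ^ m)) := by
      rw [aux_unit hm]
      intro h
      apply hk
      have := (aux_dvd_lift (q := q) (m := m) 1 hm k).1 (by simpa using h)
      simpa using this
    exact ⟨this.unit, by push_cast; simp⟩

lemma aux_mul_zero (v k : ℕ) (hk : k ≤ m) (u : (ZMod (q ^ m))ˣ) :
    (q : ZMod (q ^ m)) ^ k ∣ (q : ZMod (q ^ m)) ^ v * u ↔ k ≤ v := by
  rw [Units.dvd_mul_right, ← Nat.cast_pow q v, aux_dvd_lift k hk]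
  exact Nat.pow_dvd_pow_iff_le_right (Fact.out : q.Prime).one_lt

lemma aux_zero_iff (x : ZMod (q ^ m)) : x = 0 ↔ (q : ZMod (q ^ m)) ^ m ∣ x := by
  rw [aux_qpow, zero_dvd_iff]

/-- the number of square roots -/
noncomputable def NN (q m : ℕ) [NeZero (q ^ m)] (s : ZMod (q ^ m)) : ℕ :=
  (Finset.univ.filter fun y : ZMod (q ^ m) => y ^ 2 = s).card

lemma aux_count [NeZero (q ^ m)] (k : ℕ) (hk : k ≤ m) :
    (Finset.univ.filter fun y : ZMod (q ^ m) => (q : ZMod (q ^ m)) ^ k ∣ y).card = q ^ (m - k) := by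
  have hq : 0 < q := (Fact.out : q.Prime).pos
  have e : q ^ k * q ^ (m - k) = q ^ m := by rw [← pow_add]; congr 1; omega
  rw [← Finset.card_range (q ^ (m - k))]
  symm
  refine Finset.card_bij (fun i _ => ((q ^ k * i : ℕ) : ZMod (q ^ m))) ?_ ?_ ?_
  · intro i _
    rw [Finset.mem_filter]
    exact ⟨Finset.mem_univ _, i, by push_cast; rfl⟩
  · intro i hi j hj hij
    rw [Finset.mem_range] at hi hj
    have h1 : q ^ k * i < q ^ m := by rw [← e]; exact Nat.mul_lt_mul_of_pos_left hi (pow_pos hq k)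
    have h2 : q ^ k * j < q ^ m := by rw [← e]; exact Nat.mul_lt_mul_of_pos_left hj (pow_pos hq k)
    have := (ZMod.natCast_eq_natCast_iff' _ _ _).1 hij
    rw [Nat.mod_eq_of_lt h1, Nat.mod_eq_of_lt h2] at this
    exact Nat.eq_of_mul_eq_mul_left (pow_pos hq k) this
  · intro y hy
    rw [Finset.mem_filter] at hy
    obtain ⟨n, hn, rfl⟩ := aux_nat y
    obtain ⟨i, rfl⟩ := (aux_dvd_lift k hk n).1 hy.2
    refine ⟨i, ?_, rfl⟩
    rw [← e] at hn
    exact Finset.mem_range.2 (Nat.lt_of_mul_lt_mul_left hn)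

lemma aux_sq (hm : 2 ≤ m) (hme : Even m) (y : ZMod (q ^ m))
    (hy : (q : ZMod (q ^ m)) ^ (m - 1) ∣ y ^ 2) : (q : ZMod (q ^ m)) ^ (m / 2) ∣ y := by
  by_cases h0 : y = 0
  · simp [h0]
  obtain ⟨v, hv, u, rfl⟩ := aux_struct (by omega) y h0
  have : ((q : ZMod (q ^ m)) ^ v * u) ^ 2 = (q : ZMod (q ^ m)) ^ (2 * v) * (u ^ 2 : (ZMod (q ^ m))ˣ) := by
    push_cast; ring
  rw [this, aux_mul_zero _ _ (by omega)] at hy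
  rw [aux_mul_zero _ _ (by omega)]
  obtain ⟨r, rfl⟩ := hme
  omega

lemma aux_sq_zero (hme : Even m) (y : ZMod (q ^ m))
    (hy : (q : ZMod (q ^ m)) ^ (m / 2) ∣ y) : y ^ 2 = 0 := by
  obtain ⟨c, rfl⟩ := hy
  obtain ⟨r, rfl⟩ := hme
  rw [mul_pow, ← pow_mul, aux_qpow_ge (by omega), zero_mul]

lemma NN_zero [NeZero (q ^ m)] (hm : 2 ≤ m) (hme : Even m) : NN q m 0 = q ^ (m / 2) := by
  have h := aux_count (q := q) (m := m) (m / 2) (by omega)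
  have e : m - m / 2 = m / 2 := by obtain ⟨r, rfl⟩ := hme; omega
  rw [e] at h
  rw [NN, ← h]
  congr 1
  ext y
  simp only [Finset.mem_filter, Finset.mem_univ, true_and]
  exact ⟨fun hy => aux_sq hm hme y (by simp [hy]), aux_sq_zero hme y⟩

lemma NN_odd [NeZero (q ^ m)] (hm : 2 ≤ m) (hme : Even m) (s : ZMod (q ^ m))
    (hs : (q : ZMod (q ^ m)) ^ (m - 1) ∣ s) (h0 : s ≠ 0) : NN q m s = 0 := by
  rw [NN, Finset.card_eq_zero, Finset.filter_eq_empty_iff]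
  intro y _ hy
  subst hy
  exact h0 (aux_sq_zero hme y (aux_sq hm hme y hs))

lemma aux_qm1 (hm : 2 ≤ m) (c : ZMod (q ^ m)) :
    (q : ZMod (q ^ m)) ^ (m - 1) * c = 0 ↔ (q : ZMod (q ^ m)) ∣ c := by
  constructor
  · intro h
    by_contra hc
    obtain ⟨u, rfl⟩ := (aux_unit (by omega) c).2 hc
    rw [aux_zero_iff, aux_mul_zero _ _ le_rfl] at h
    omega
  · rintro ⟨d, rfl⟩
    rw [← mul_assoc, ← pow_succ, aux_qpow_ge (by omega), zero_mul]

lemma sum_NN_zero [NeZero (q ^ m)] (hm : 2 ≤ m) (hme : Even m) :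
    ∑ c : ZMod (q ^ m), NN q m ((q : ZMod (q ^ m)) ^ (m - 1) * c) = q ^ (m / 2) * q ^ (m - 1) := by
  have h := aux_count (q := q) (m := m) 1 (by omega)
  rw [← h, mul_comm, ← smul_eq_mul, ← Finset.sum_const, Finset.sum_filter]
  refine Finset.sum_congr rfl fun c _ => ?_
  rw [pow_one]
  split_ifs with hc
  · rw [(aux_qm1 hm c).2 hc, NN_zero hm hme]
  · exact NN_odd hm hme _ (Dvd.intro _ rfl) fun h => hc ((aux_qm1 hm c).1 h)

lemma sum_NN_dvd [NeZero (q ^ m)] (hm : 2 ≤ m) (hme : Even m) (s : ZMod (q ^ m))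
    (hs : (q : ZMod (q ^ m)) ^ (m - 1) ∣ s) :
    ∑ c : ZMod (q ^ m), NN q m (s + (q : ZMod (q ^ m)) ^ (m - 1) * c) =
      q ^ (m / 2) * q ^ (m - 1) := by
  obtain ⟨d, rfl⟩ := hs
  rw [← sum_NN_zero hm hme,
    ← Equiv.sum_comp (Equiv.addLeft d) fun c => NN q m ((q : ZMod (q ^ m)) ^ (m - 1) * c)]
  refine Finset.sum_congr rfl fun c _ => ?_
  rw [Equiv.coe_addLeft, mul_add]

lemma aux_two (hq : Odd q) : IsUnit (2 : ZMod (q ^ m)) := by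
  have : IsUnit ((2 : ℕ) : ZMod (q ^ m)) := by
    rw [ZMod.isUnit_iff_coprime]
    exact (Odd.pow hq).coprime_two_left
  simpa using this

lemma NN_shift [NeZero (q ^ m)] (hq : Odd q) (hm : 2 ≤ m) (s c : ZMod (q ^ m))
    (hs : ¬ (q : ZMod (q ^ m)) ^ (m - 1) ∣ s) :
    NN q m (s + (q : ZMod (q ^ m)) ^ (m - 1) * c) = NN q m s := by
  have h0 : s ≠ 0 := by rintro rfl; exact hs (dvd_zero _)
  obtain ⟨v, hv, u, rfl⟩ := aux_struct (by omega) s h0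
  rw [aux_mul_zero _ _ (by omega)] at hs
  obtain ⟨t, ht⟩ := aux_two (m := m) hq
  obtain ⟨j, hj⟩ : ∃ j, j + v = m - 1 := ⟨m - 1 - v, by omega⟩
  set d : ZMod (q ^ m) := c * (u⁻¹ : (ZMod (q ^ m))ˣ) * (t⁻¹ : (ZMod (q ^ m))ˣ) with hd
  have hc : c = 2 * u * d := by
    rw [hd, ← ht]
    have h1 : (u : ZMod (q ^ m)) * (u⁻¹ : (ZMod (q ^ m))ˣ) = 1 := Units.mul_inv u
    have h2 : (t : ZMod (q ^ m)) * (t⁻¹ : (ZMod (q ^ m))ˣ) = 1 := Units.mul_inv t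
    linear_combination (-c * (t : ZMod (q ^ m)) * (t⁻¹ : (ZMod (q ^ m))ˣ)) * h1 - c * h2
  have hw : IsUnit (1 + (q : ZMod (q ^ m)) ^ j * d) := by
    rw [aux_unit (by omega)]
    intro h
    have h2 : (q : ZMod (q ^ m)) ∣ (q : ZMod (q ^ m)) ^ j * d :=
      Dvd.dvd.mul_right (dvd_pow_self _ (by omega)) _
    have h3 := (dvd_add_left h2).1 h
    exact (aux_unit (q := q) (m := m) (by omega) 1).1 isUnit_one h3
  obtain ⟨w, hw⟩ := hw
  have key : (q : ZMod (q ^ m)) ^ v * u + (q : ZMod (q ^ m)) ^ (m - 1) * c =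
      (q : ZMod (q ^ m)) ^ v * u * (w : ZMod (q ^ m)) ^ 2 := by
    have hz : (q : ZMod (q ^ m)) ^ (v + 2 * j) = 0 := aux_qpow_ge (by omega)
    rw [hw, ← hj, hc]
    linear_combination (-(u : ZMod (q ^ m)) * d ^ 2) * hz
  rw [key, NN, NN]
  symm
  refine Finset.card_bij (fun y _ => y * w) ?_ ?_ ?_
  · intro y hy
    rw [Finset.mem_filter] at hy ⊢
    exact ⟨Finset.mem_univ _, by rw [mul_pow, hy.2]⟩
  · intro y _ z _ h
    exact (Units.mul_left_inj w).1 h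
  · intro y hy
    rw [Finset.mem_filter] at hy
    refine ⟨y * (w⁻¹ : (ZMod (q ^ m))ˣ), ?_, Units.inv_mul_cancel_right _ _⟩
    rw [Finset.mem_filter]
    refine ⟨Finset.mem_univ _, ?_⟩
    rw [mul_pow, hy.2, mul_assoc, ← mul_pow, Units.mul_inv, one_pow, mul_one]

lemma aux_castHom (hm : 2 ≤ m) (u : ZMod (q ^ m)) :
    ZMod.castHom (pow_dvd_pow q (Nat.sub_le m 1)) (ZMod (q ^ (m - 1))) u = 1 ↔
      ∃ c, u = 1 + (q : ZMod (q ^ m)) ^ (m - 1) * c := by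
  constructor
  · intro h
    obtain ⟨n, -, hn⟩ := aux_nat (u - 1)
    have h2 : ZMod.castHom (pow_dvd_pow q (Nat.sub_le m 1)) (ZMod (q ^ (m - 1))) (u - 1) = 0 := by
      rw [map_sub, h, map_one, sub_self]
    rw [← hn, map_natCast, ZMod.natCast_eq_zero_iff] at h2
    obtain ⟨c, hc⟩ := (aux_dvd_lift (q := q) (m := m) (m - 1) (by omega) n).2 h2
    exact ⟨c, by rw [← hc, hn]; ring⟩
  · rintro ⟨c, rfl⟩
    rw [map_add, map_one, map_mul, map_pow, map_natCast, ← Nat.cast_pow, ZMod.natCast_self,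
      zero_mul, add_zero]

lemma aux_one_add_unit (hm : 2 ≤ m) (c : ZMod (q ^ m)) :
    IsUnit (1 + (q : ZMod (q ^ m)) ^ (m - 1) * c) := by
  rw [aux_unit (by omega)]
  intro h
  have h2 : (q : ZMod (q ^ m)) ∣ (q : ZMod (q ^ m)) ^ (m - 1) * c :=
    Dvd.dvd.mul_right (dvd_pow_self _ (by omega)) _
  have h3 := (dvd_add_left h2).1 h
  exact (aux_unit (q := q) (m := m) (by omega) 1).1 isUnit_one h3

lemma aux_one_add_mul (hm : 2 ≤ m) (c d : ZMod (q ^ m)) :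
    (1 + (q : ZMod (q ^ m)) ^ (m - 1) * c) * (1 + (q : ZMod (q ^ m)) ^ (m - 1) * d) =
      1 + (q : ZMod (q ^ m)) ^ (m - 1) * (c + d) := by
  have hz : (q : ZMod (q ^ m)) ^ ((m - 1) + (m - 1)) = 0 := aux_qpow_ge (by omega)
  linear_combination c * d * hz

open Classical in
lemma aux_prim [NeZero (q ^ m)] (hm : 2 ≤ m) (χ : DirichletCharacter ℂ (q ^ m)) :
    ∑ c : ZMod (q ^ m), χ⁻¹ (1 + (q : ZMod (q ^ m)) ^ (m - 1) * c) =
      if IsPrim q m χ then 0 else (q : ℂ) ^ m := by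
  have hinv : ∀ c : ZMod (q ^ m), χ (1 + (q : ZMod (q ^ m)) ^ (m - 1) * c) *
      χ⁻¹ (1 + (q : ZMod (q ^ m)) ^ (m - 1) * c) = 1 := by
    intro c
    rw [← MulChar.mul_apply, mul_inv_cancel, MulChar.one_apply (aux_one_add_unit hm c)]
  split_ifs with h
  · obtain ⟨u, hu, hχ⟩ := h
    obtain ⟨d, hd⟩ := (aux_castHom hm _).1 hu
    rw [hd] at hχ
    have h1 : χ⁻¹ (1 + (q : ZMod (q ^ m)) ^ (m - 1) * d) ≠ 1 := by
      intro h
      have := hinv d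
      rw [h, mul_one] at this
      exact hχ this
    have h2 : ∑ c : ZMod (q ^ m), χ⁻¹ (1 + (q : ZMod (q ^ m)) ^ (m - 1) * c) =
        χ⁻¹ (1 + (q : ZMod (q ^ m)) ^ (m - 1) * d) *
        ∑ c : ZMod (q ^ m), χ⁻¹ (1 + (q : ZMod (q ^ m)) ^ (m - 1) * c) := by
      rw [Finset.mul_sum, ← Equiv.sum_comp (Equiv.addLeft d)
        fun c => χ⁻¹ (1 + (q : ZMod (q ^ m)) ^ (m - 1) * c)]
      refine Finset.sum_congr rfl fun c _ => ?_
      rw [← map_mul, aux_one_add_mul hm, Equiv.coe_addLeft]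
    have h3 : (1 - χ⁻¹ (1 + (q : ZMod (q ^ m)) ^ (m - 1) * d)) *
        ∑ c : ZMod (q ^ m), χ⁻¹ (1 + (q : ZMod (q ^ m)) ^ (m - 1) * c) = 0 := by
      linear_combination h2
    rcases mul_eq_zero.1 h3 with h4 | h4
    · exact absurd (sub_eq_zero.1 h4).symm h1
    · exact h4
  · have h1 : ∀ c : ZMod (q ^ m), χ⁻¹ (1 + (q : ZMod (q ^ m)) ^ (m - 1) * c) = 1 := by
      intro c
      obtain ⟨u, hu⟩ := aux_one_add_unit hm c
      have h2 : χ (1 + (q : ZMod (q ^ m)) ^ (m - 1) * c) = 1 := by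
        by_contra h3
        exact h ⟨u, (aux_castHom hm _).2 ⟨c, hu⟩, by rwa [hu]⟩
      have := hinv c
      rwa [h2, one_mul] at this
    rw [Finset.sum_congr rfl fun c _ => h1 c]
    simp

lemma aux_NN_cast [NeZero (q ^ m)] (hq : Odd q) (t : ZMod (q ^ m)) :
    ∑ x : ZMod (q ^ m), (if t = -4 * (x * (1 - x)) then (1 : ℂ) else 0) = NN q m (1 + t) := by
  obtain ⟨w, hw⟩ := aux_two (m := m) hq
  rw [NN, Finset.sum_boole]
  congr 1
  refine Finset.card_bij (fun x _ => 2 * x - 1) ?_ ?_ ?_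
  · intro x hx
    simp only [Finset.mem_filter, Finset.mem_univ, true_and] at hx ⊢
    rw [hx]; ring
  · intro x _ y _ h
    have : (w : ZMod (q ^ m)) * x = w * y := by rw [hw]; linear_combination h
    exact (Units.mul_right_inj w).1 this
  · intro y hy
    simp only [Finset.mem_filter, Finset.mem_univ, true_and] at hy
    have e : 2 * ((w⁻¹ : (ZMod (q ^ m))ˣ) * (y + 1)) - 1 = y := by
      rw [← hw, Units.mul_inv_cancel_left]; ring
    refine ⟨(w⁻¹ : (ZMod (q ^ m))ˣ) * (y + 1), ?_, e⟩
    simp only [Finset.mem_filter, Finset.mem_univ, true_and]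
    rw [← e] at hy
    linear_combination -hy

lemma aux_orth [NeZero (q ^ m)] (hq : Odd q) (t : ZMod (q ^ m)) (ht : IsUnit t) :
    ∑ χ : DirichletCharacter ℂ (q ^ m), χ (-4) * jacobiS (q ^ m) χ χ * χ⁻¹ t =
      (q ^ m).totient * NN q m (1 + t) := by
  rw [← aux_NN_cast hq, Finset.mul_sum]
  simp only [jacobiS, Finset.mul_sum, Finset.sum_mul]
  rw [Finset.sum_comm]
  refine Finset.sum_congr rfl fun x _ => ?_
  have := DirichletCharacter.sum_char_inv_mul_char_eq ℂ ht (-4 * (x * (1 - x)))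
  rw [mul_ite, mul_one, mul_zero, ← this]
  refine Finset.sum_congr rfl fun χ _ => ?_
  obtain ⟨u, rfl⟩ := ht
  rw [map_mul, map_mul, MulChar.inv_apply, Ring.inverse_unit, ZMod.inv_coe_unit]
  ring

lemma aux_F [NeZero (q ^ m)] (hq : Odd q) (hm : 2 ≤ m) (t : ZMod (q ^ m)) (ht : IsUnit t) :
    (q : ℂ) ^ m * ∑ᶠ χ ∈ {χ : DirichletCharacter ℂ (q ^ m) | IsPrim q m χ},
        χ (-4) * jacobiS (q ^ m) χ χ * χ⁻¹ t =
      (q ^ m).totient * ((q : ℂ) ^ m * NN q m (1 + t) -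
        (∑ c : ZMod (q ^ m), NN q m (1 + t + (q : ZMod (q ^ m)) ^ (m - 1) * c) : ℕ)) := by
  classical
  have h1 : ∑ c : ZMod (q ^ m), NN q m (1 + t + (q : ZMod (q ^ m)) ^ (m - 1) * c) =
      ∑ c : ZMod (q ^ m), NN q m (1 + t * (1 + (q : ZMod (q ^ m)) ^ (m - 1) * c)) := by
    obtain ⟨u, rfl⟩ := ht
    rw [← Equiv.sum_comp (Units.mulLeft u)
      fun c => NN q m (1 + u + (q : ZMod (q ^ m)) ^ (m - 1) * c)]
    refine Finset.sum_congr rfl fun c _ => ?_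
    congr 1
    simp only [Units.mulLeft_apply]
    ring
  have h2 : ∀ χ : DirichletCharacter ℂ (q ^ m),
      ∑ c : ZMod (q ^ m), χ (-4) * jacobiS (q ^ m) χ χ *
        χ⁻¹ (t * (1 + (q : ZMod (q ^ m)) ^ (m - 1) * c)) =
      χ (-4) * jacobiS (q ^ m) χ χ * χ⁻¹ t * if IsPrim q m χ then 0 else (q : ℂ) ^ m := by
    intro χ
    rw [← aux_prim hm, Finset.mul_sum]
    refine Finset.sum_congr rfl fun c _ => ?_
    rw [map_mul, mul_assoc _ (χ⁻¹ t)]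
  have h3 : ((q ^ m).totient : ℂ) * (∑ c : ZMod (q ^ m), NN q m (1 + t + (q : ZMod (q ^ m)) ^ (m - 1) * c) : ℕ)
      = ∑ χ : DirichletCharacter ℂ (q ^ m),
      χ (-4) * jacobiS (q ^ m) χ χ * χ⁻¹ t * if IsPrim q m χ then 0 else (q : ℂ) ^ m := by
    rw [← Finset.sum_congr rfl fun χ _ => h2 χ, Finset.sum_comm, h1, Nat.cast_sum, Finset.mul_sum]
    refine Finset.sum_congr rfl fun c _ => ?_
    rw [aux_orth hq _ (ht.mul (aux_one_add_unit hm c))]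
  have h4 : ∑ᶠ χ ∈ {χ : DirichletCharacter ℂ (q ^ m) | IsPrim q m χ},
        χ (-4) * jacobiS (q ^ m) χ χ * χ⁻¹ t = ∑ χ : DirichletCharacter ℂ (q ^ m),
        if IsPrim q m χ then χ (-4) * jacobiS (q ^ m) χ χ * χ⁻¹ t else 0 := by
    rw [← Finset.sum_filter]
    rw [← finsum_mem_coe_finset]
    simp only [Finset.coe_filter, Finset.mem_univ, true_and]
  rw [h4, mul_sub, h3, ← mul_assoc, mul_comm _ ((q : ℂ) ^ m), mul_assoc, ← aux_orth hq t ht,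
    Finset.mul_sum, Finset.mul_sum, ← Finset.sum_sub_distrib]
  refine Finset.sum_congr rfl fun χ _ => ?_
  split_ifs <;> ring

lemma aux_near (hq : Odd q) (hm : 2 ≤ m) (a : ZMod (q ^ m)) (a₀ : (ZMod (q ^ m))ˣ)
    (h : (q : ZMod (q ^ m)) ^ (m - 1) ∣ a ^ 2 - (a₀ : ZMod (q ^ m)) ^ 2) :
    (a = (a₀ : ZMod (q ^ m)) ∨ a = -(a₀ : ZMod (q ^ m))) ∨ 
      (∃ u : ℕ, 1 ≤ u ∧ u ≤ q - 1 ∧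
        (a = (a₀ : ZMod (q ^ m)) * (1 + (q : ZMod (q ^ m)) ^ (m - 1) * (u : ZMod (q ^ m))) ∨
          a = -((a₀ : ZMod (q ^ m)) * (1 + (q : ZMod (q ^ m)) ^ (m - 1) * (u : ZMod (q ^ m)))))) := by
  have main : ∀ b : ZMod (q ^ m), (q : ZMod (q ^ m)) ^ (m - 1) ∣ b - a₀ → b = a₀ ∨
      ∃ u : ℕ, 1 ≤ u ∧ u ≤ q - 1 ∧
        b = (a₀ : ZMod (q ^ m)) * (1 + (q : ZMod (q ^ m)) ^ (m - 1) * (u : ZMod (q ^ m))) := by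
    rintro b ⟨r, hr⟩
    obtain ⟨n, -, hn⟩ := aux_nat (((a₀⁻¹ : (ZMod (q ^ m))ˣ) : ZMod (q ^ m)) * r)
    have hr' : r = a₀ * (n : ZMod (q ^ m)) := by rw [hn, Units.mul_inv_cancel_left]
    have hb : b = a₀ * (1 + (q : ZMod (q ^ m)) ^ (m - 1) * ((n % q : ℕ) : ZMod (q ^ m))) := by
      have h1 : (n : ZMod (q ^ m)) = q * ((n / q : ℕ) : ZMod (q ^ m)) + ((n % q : ℕ) : ZMod (q ^ m)) := by
        rw [← Nat.cast_mul, ← Nat.cast_add, Nat.div_add_mod]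
      have hz : (q : ZMod (q ^ m)) ^ ((m - 1) + 1) = 0 := aux_qpow_ge (by omega)
      rw [hr', h1] at hr
      linear_combination hr + a₀ * ((n / q : ℕ) : ZMod (q ^ m)) * hz
    have hlt := Nat.mod_lt n (Fact.out : q.Prime).pos
    by_cases h0 : n % q = 0
    · left; rw [hb, h0]; simp
    · right; exact ⟨n % q, by omega, by omega, hb⟩
  have main2 : (q : ZMod (q ^ m)) ^ (m - 1) ∣ a - a₀ ∨ (q : ZMod (q ^ m)) ^ (m - 1) ∣ -a - a₀ := by
    have hf : a ^ 2 - (a₀ : ZMod (q ^ m)) ^ 2 = (a - a₀) * (a + a₀) := by ring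
    rw [hf] at h
    by_cases h1 : IsUnit (a - a₀)
    · right
      have := h1.dvd_mul_left.1 h
      have e : -a - (a₀ : ZMod (q ^ m)) = -(a + a₀) := by ring
      rwa [e, dvd_neg]
    · left
      have h2 : IsUnit (a + a₀) := by
        rw [aux_unit (by omega), not_not] at h1
        rw [aux_unit (by omega)]
        intro h2
        have h3 := dvd_sub h2 h1
        have h4 : IsUnit (2 * (a₀ : ZMod (q ^ m))) := (aux_two hq).mul a₀.isUnit
        rw [aux_unit (by omega)] at h4
        apply h4
        convert h3 using 1
        ring
      exact h2.dvd_mul_right.1 h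
  rcases main2 with h | h
  · rcases main _ h with h | ⟨u, h1, h2, h3⟩
    · exact Or.inl (Or.inl h)
    · exact Or.inr ⟨u, h1, h2, Or.inl h3⟩
  · rcases main _ h with h | ⟨u, h1, h2, h3⟩
    · exact Or.inl (Or.inr (by rw [← h, neg_neg]))
    · exact Or.inr ⟨u, h1, h2, Or.inr (by rw [← h3, neg_neg])⟩

end helpers

theorem stmt3 (q m : ℕ) [Fact q.Prime] (hq : Odd q) (hm : 2 ≤ m) (hme : Even m)
    (e a₀ : (ZMod (q ^ m))ˣ)
    (he : ¬ ∃ y : ZMod q,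
      y ^ 2 = ZMod.castHom (dvd_pow_self q (by omega : m ≠ 0)) (ZMod q) (e : ZMod (q ^ m)))
    (ha₀ : (a₀ : ZMod (q ^ m)) ^ 2 = (e : ZMod (q ^ m)) - 1)
    (F : ZMod (q ^ m) → ℂ)
    (hF : ∀ a : ZMod (q ^ m), F a =
      ∑ᶠ χ ∈ {χ : DirichletCharacter ℂ (q ^ m) | IsPrim q m χ},
        χ (-4) * jacobiS (q ^ m) χ χ * χ⁻¹ (a ^ 2 - (e : ZMod (q ^ m)))) :
    (∀ a : ZMod (q ^ m), (a = (a₀ : ZMod (q ^ m)) ∨ a = -(a₀ : ZMod (q ^ m))) →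
      F a = (q : ℂ) ^ (3 * m / 2 - 2) * ((q : ℂ) - 1) ^ 2) ∧
    (∀ a : ZMod (q ^ m),
      (∃ u : ℕ, 1 ≤ u ∧ u ≤ q - 1 ∧
        (a = (a₀ : ZMod (q ^ m)) * (1 + (q : ZMod (q ^ m)) ^ (m - 1) * (u : ZMod (q ^ m))) ∨
          a = -((a₀ : ZMod (q ^ m)) * (1 + (q : ZMod (q ^ m)) ^ (m - 1) * (u : ZMod (q ^ m)))))) →
      F a = -((q : ℂ) ^ (3 * m / 2 - 2) * ((q : ℂ) - 1))) ∧
    (∀ a : ZMod (q ^ m),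
      ¬(a = (a₀ : ZMod (q ^ m)) ∨ a = -(a₀ : ZMod (q ^ m))) →
      ¬(∃ u : ℕ, 1 ≤ u ∧ u ≤ q - 1 ∧
        (a = (a₀ : ZMod (q ^ m)) * (1 + (q : ZMod (q ^ m)) ^ (m - 1) * (u : ZMod (q ^ m))) ∨
          a = -((a₀ : ZMod (q ^ m)) * (1 + (q : ZMod (q ^ m)) ^ (m - 1) * (u : ZMod (q ^ m)))))) →
      F a = 0) := by
  have hqp : q.Prime := Fact.out
  have hq0 : (q : ℂ) ≠ 0 := Nat.cast_ne_zero.2 hqp.ne_zero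
  haveI : NeZero (q ^ m) := ⟨pow_ne_zero _ hqp.ne_zero⟩
  have ht : ∀ a : ZMod (q ^ m), IsUnit (a ^ 2 - (e : ZMod (q ^ m))) := by
    intro a
    rw [aux_unit (by omega)]
    rintro ⟨c, hc⟩
    apply he
    refine ⟨ZMod.castHom (dvd_pow_self q (by omega : m ≠ 0)) (ZMod q) a, ?_⟩
    rw [← map_pow, ← sub_eq_zero, ← map_sub, hc, map_mul, map_natCast, ZMod.natCast_self, zero_mul]
  have hs : ∀ a : ZMod (q ^ m), 1 + (a ^ 2 - (e : ZMod (q ^ m))) = a ^ 2 - (a₀ : ZMod (q ^ m)) ^ 2 := by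
    intro a; rw [ha₀]; ring
  have key : ∀ a : ZMod (q ^ m), (q : ℂ) ^ m * F a = (q ^ m).totient * ((q : ℂ) ^ m *
      NN q m (a ^ 2 - (a₀ : ZMod (q ^ m)) ^ 2) - (∑ c : ZMod (q ^ m),
        NN q m (a ^ 2 - (a₀ : ZMod (q ^ m)) ^ 2 + (q : ZMod (q ^ m)) ^ (m - 1) * c) : ℕ)) := by
    intro a
    have := aux_F hq hm _ (ht a)
    rw [hs] at this
    rw [hF, ← this]
  have htot : ((q ^ m).totient : ℂ) = (q : ℂ) ^ (m - 1) * ((q : ℂ) - 1) := by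
    rw [Nat.totient_prime_pow hqp (by omega)]
    push_cast [hqp.one_le]
    rfl
  have hqm : (q : ℂ) ^ m ≠ 0 := pow_ne_zero _ hq0
  obtain ⟨r, hr⟩ := id hme
  obtain ⟨k, rfl⟩ : ∃ k, r = k + 1 := ⟨r - 1, by omega⟩
  have e1 : m / 2 = k + 1 := by omega
  have e2 : m - 1 = 2 * k + 1 := by omega
  have e3 : 3 * m / 2 - 2 = 3 * k + 1 := by omega
  have e4 : (q : ℂ) ^ m = (q : ℂ) ^ (2 * k + 2) := by congr 1; omega
  refine ⟨?_, ?_, ?_⟩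
  · intro a ha
    have h0 : a ^ 2 - (a₀ : ZMod (q ^ m)) ^ 2 = 0 := by
      rcases ha with rfl | rfl <;> ring
    have := key a
    rw [h0, sum_NN_dvd hm hme 0 (dvd_zero _), NN_zero hm hme, htot, e1, e2, e4] at this
    rw [e4] at hqm
    apply mul_left_cancel₀ hqm
    rw [this, e3]
    push_cast
    ring
  · rintro a ⟨u, hu1, hu2, ha⟩
    have hz : (q : ZMod (q ^ m)) ^ ((m - 1) + (m - 1)) = 0 := aux_qpow_ge (by omega)
    have h0 : a ^ 2 - (a₀ : ZMod (q ^ m)) ^ 2 =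
        (q : ZMod (q ^ m)) ^ (m - 1) * (2 * (a₀ : ZMod (q ^ m)) ^ 2 * u) := by
      rcases ha with rfl | rfl <;>
      linear_combination (a₀ : ZMod (q ^ m)) ^ 2 * (u : ZMod (q ^ m)) ^ 2 * hz
    have hd : (q : ZMod (q ^ m)) ^ (m - 1) ∣ a ^ 2 - (a₀ : ZMod (q ^ m)) ^ 2 := ⟨_, h0⟩
    have hne : a ^ 2 - (a₀ : ZMod (q ^ m)) ^ 2 ≠ 0 := by
      rw [h0, Ne, aux_qm1 hm, ← aux_unit (by omega)]
      refine ((aux_two hq).mul (a₀.isUnit.pow 2)).mul ?_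
      rw [ZMod.isUnit_iff_coprime]
      refine Nat.Coprime.pow_right _ (Nat.Coprime.symm ?_)
      rw [hqp.coprime_iff_not_dvd]
      exact Nat.not_dvd_of_pos_of_lt (by omega) (by omega)
    have := key a
    rw [sum_NN_dvd hm hme _ hd, NN_odd hm hme _ hd hne, htot, e1, e2, e4] at this
    rw [e4] at hqm
    apply mul_left_cancel₀ hqm
    rw [this, e3]
    push_cast
    ring
  · intro a h1 h2
    have hd : ¬ (q : ZMod (q ^ m)) ^ (m - 1) ∣ a ^ 2 - (a₀ : ZMod (q ^ m)) ^ 2 := by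
      intro h
      rcases aux_near hq hm a a₀ h with h | h
      · exact h1 h
      · exact h2 h
    have := key a
    rw [Finset.sum_congr rfl fun c _ => NN_shift hq hm _ c hd] at this
    apply mul_left_cancel₀ hqm
    rw [this]
    simp
end

section
/- Let q be an odd prime, m ≥ 2 an integer, and a ∈ (ZMod (q^m))ˣ. Then the sum of χ(a) over all primitive Dirichlet characters χ modulo q^m equals: (q−1)²·q^(m−2) if a = 1; −(q−1)·q^(m−2) if a ≡ 1 (mod q^(m−1)) but a ≠ 1; and 0 if a ≢ 1 (mod q^(m−1)). -/
theorem stmt5 (q m : ℕ) [Fact q.Prime] (hq : Odd q) (hm : 2 ≤ m)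
    (a : (ZMod (q ^ m))ˣ) :
    (∑ᶠ χ ∈ {χ : DirichletCharacter ℂ (q ^ m) | IsPrim q m χ}, χ (a : ZMod (q ^ m))) =
      if (a : ZMod (q ^ m)) = 1 then ((q : ℂ) - 1) ^ 2 * (q : ℂ) ^ (m - 2)
      else if ZMod.castHom (pow_dvd_pow q (Nat.sub_le m 1)) (ZMod (q ^ (m - 1)))
          (a : ZMod (q ^ m)) = 1 then
        -(((q : ℂ) - 1) * (q : ℂ) ^ (m - 2))
      else 0 := by
  classical
  have hp : q.Prime := Fact.out
  haveI : NeZero q := ⟨hp.ne_zero⟩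
  haveI : NeZero (q ^ m) := ⟨pow_ne_zero _ hp.ne_zero⟩
  haveI : NeZero (q ^ (m - 1)) := ⟨pow_ne_zero _ hp.ne_zero⟩
  have hd : q ^ (m - 1) ∣ q ^ m := pow_dvd_pow q (Nat.sub_le m 1)
  have key : ∀ χ : DirichletCharacter ℂ (q ^ m),
      ¬ IsPrim q m χ ↔ χ ∈ Finset.univ.image (DirichletCharacter.changeLevel (R := ℂ) hd) := by
    intro χ
    have h1 : χ ∈ Finset.univ.image (DirichletCharacter.changeLevel (R := ℂ) hd) ↔
        χ.FactorsThrough (q ^ (m - 1)) := by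
      simp only [Finset.mem_image, Finset.mem_univ, true_and]
      constructor
      · rintro ⟨ψ, rfl⟩
        exact ⟨hd, ψ, rfl⟩
      · rintro ⟨_, ψ, h⟩
        exact ⟨ψ, h.symm⟩
    rw [h1, DirichletCharacter.factorsThrough_iff_ker_unitsMap hd]
    unfold IsPrim
    push Not
    constructor
    · intro h u hu
      rw [MonoidHom.mem_ker] at hu ⊢
      have := h u (by simpa [ZMod.unitsMap] using congrArg Units.val hu)
      ext
      simpa using this
    · intro h u hu
      have h2 : u ∈ (ZMod.unitsMap hd).ker := by
        rw [MonoidHom.mem_ker]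
        ext
        simpa [ZMod.unitsMap] using hu
      have h3 := h h2
      rw [MonoidHom.mem_ker] at h3
      simpa using congrArg Units.val h3
  have h0 : (∑ᶠ χ ∈ {χ : DirichletCharacter ℂ (q ^ m) | IsPrim q m χ}, χ (a : ZMod (q ^ m)))
      = ∑ χ with IsPrim q m χ, χ (a : ZMod (q ^ m)) := by
    rw [← finsum_mem_coe_finset]
    simp
  have h1 := Finset.sum_filter_add_sum_filter_not Finset.univ (fun χ => IsPrim q m χ)
    (fun χ : DirichletCharacter ℂ (q ^ m) => χ (a : ZMod (q ^ m)))
  have h2 : ∑ χ with ¬ IsPrim q m χ, χ (a : ZMod (q ^ m)) =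
      ∑ ψ : DirichletCharacter ℂ (q ^ (m - 1)), ψ (ZMod.castHom hd (ZMod (q ^ (m - 1))) (a : ZMod (q ^ m))) := by
    have : Finset.univ.filter (fun χ => ¬ IsPrim q m χ) =
        Finset.univ.image (DirichletCharacter.changeLevel (R := ℂ) hd) := by
      ext χ
      rw [Finset.mem_filter, key]
      simp
    rw [this, Finset.sum_image (fun x _ y _ h => DirichletCharacter.changeLevel_injective hd h)]
    refine Finset.sum_congr rfl fun ψ _ => ?_
    rw [DirichletCharacter.changeLevel_eq_cast_of_dvd]
    simp
  rw [h2, DirichletCharacter.sum_characters_eq, DirichletCharacter.sum_characters_eq] at h1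
  rw [h0]
  obtain ⟨k, rfl⟩ : ∃ k, m = k + 2 := ⟨m - 2, by omega⟩
  have e1 : ((q ^ (k + 2)).totient : ℂ) = (q : ℂ) ^ (k + 1) * (q - 1) := by
    rw [Nat.totient_prime_pow hp (by omega), Nat.cast_mul, Nat.cast_sub hp.one_le]
    simp
  have e2 : ((q ^ (k + 2 - 1)).totient : ℂ) = (q : ℂ) ^ k * (q - 1) := by
    rw [Nat.totient_prime_pow hp (by omega), Nat.cast_mul, Nat.cast_sub hp.one_le]
    simp
  rw [eq_sub_of_add_eq h1, e1, e2, Nat.add_sub_cancel]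
  by_cases ha : (a : ZMod (q ^ (k + 2))) = 1
  · rw [if_pos ha, if_pos ha, if_pos (by rw [ha, map_one])]
    ring
  · rw [if_neg ha, if_neg ha]
    split_ifs <;> ring
end

section
/- Let q be an odd prime, k ≥ 1 an integer, and b, c ∈ ZMod (q^k). Let N be the number of solutions X ∈ ZMod (q^k) of X² + 2bX + c = 0. Then: (i) if b² − c is not a square in ZMod (q^k), then N = 0; (ii) if b² − c = v² for some unit v, then N = 2; (iii) if b² − c = 0, then N = q^⌊k/2⌋; (iv) if b² − c is a nonzero square and b² − c = q^t·w for some unit w and integer t with 1 ≤ t ≤ k−1, then t is even and N = 2·q^(t/2). -/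
theorem aux_dvd (q k m : ℕ) (hm : m ≤ k) (a : ℤ) :
    ((q : ZMod (q ^ k)) ^ m ∣ (a : ZMod (q ^ k))) ↔ (q : ℤ) ^ m ∣ a := by
  constructor
  · rintro ⟨z, hz⟩
    obtain ⟨z, rfl⟩ := ZMod.intCast_surjective z
    have h : ((a - (q : ℤ) ^ m * z : ℤ) : ZMod (q ^ k)) = 0 := by
      push_cast; rw [hz]; ring
    rw [ZMod.intCast_zmod_eq_zero_iff_dvd] at h
    have h2 : (q : ℤ) ^ m ∣ a - (q : ℤ) ^ m * z := by
      refine dvd_trans ?_ h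
      push_cast
      exact pow_dvd_pow _ hm
    exact (dvd_sub_left (Dvd.intro _ rfl)).mp h2
  · rintro ⟨z, rfl⟩
    push_cast
    exact Dvd.intro _ rfl

theorem aux_zero (q k : ℕ) (a : ℤ) :
    ((a : ZMod (q ^ k)) = 0) ↔ (q : ℤ) ^ k ∣ a := by
  rw [ZMod.intCast_zmod_eq_zero_iff_dvd]; push_cast; rfl

theorem aux_mul (p : ℤ) (hp : Prime p) (k s : ℕ) (a b : ℤ) (h : p ^ k ∣ a * b)
    (ha : ¬ p ^ (s + 1) ∣ a) : p ^ (k - s) ∣ b := by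
  induction s generalizing a k with
  | zero =>
    exact hp.pow_dvd_of_dvd_mul_left k (by simpa using ha) h
  | succ s ih =>
    by_cases hpa : p ∣ a
    · obtain ⟨a, rfl⟩ := hpa
      have ha' : ¬ p ^ (s + 1) ∣ a := by
        intro h'
        apply ha
        rw [pow_succ' p (s + 1)]
        exact mul_dvd_mul_left p h'
      rcases k with _ | k
      · simp
      · rw [pow_succ', mul_assoc] at h
        have := ih k a ((mul_dvd_mul_iff_left hp.ne_zero).mp h) ha'
        rwa [Nat.add_sub_add_right]
    · exact dvd_trans (pow_dvd_pow _ (Nat.sub_le _ _)) (hp.pow_dvd_of_dvd_mul_left k hpa h)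

theorem aux_card0 (q k m : ℕ) [Fact q.Prime] (hm : m ≤ k) [DecidablePred fun Y : ZMod (q ^ k) => (q : ZMod (q ^ k)) ^ m ∣ Y] :
    (Finset.univ.filter (fun Y : ZMod (q ^ k) => (q : ZMod (q ^ k)) ^ m ∣ Y)).card
      = q ^ (k - m) := by
  have hq0 : 0 < q := (Fact.out : q.Prime).pos
  have hk : q ^ m * q ^ (k - m) = q ^ k := by rw [← pow_add]; congr 1; omega
  symm
  rw [← Finset.card_range (q ^ (k - m))]
  refine Finset.card_bij (fun j _ => ((q ^ m * j : ℕ) : ZMod (q ^ k))) ?_ ?_ ?_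
  · intro j _
    simp
  · intro i hi j hj h
    rw [Finset.mem_range] at hi hj
    rw [ZMod.natCast_eq_natCast_iff'] at h
    have hpm : 0 < q ^ m := by positivity
    rw [Nat.mod_eq_of_lt, Nat.mod_eq_of_lt] at h
    · exact Nat.eq_of_mul_eq_mul_left hpm h
    · rw [← hk]; exact Nat.mul_lt_mul_of_pos_left hj hpm
    · rw [← hk]; exact Nat.mul_lt_mul_of_pos_left hi hpm
  · intro Y hY
    rw [Finset.mem_filter] at hY
    have h := hY.2
    have hv : ((Y.val : ℤ) : ZMod (q ^ k)) = Y := by simp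
    rw [← hv, aux_dvd q k m hm] at h
    have h' : q ^ m ∣ Y.val := by exact_mod_cast h
    obtain ⟨j, hj⟩ := h'
    refine ⟨j, ?_, ?_⟩
    · rw [Finset.mem_range]
      have := ZMod.val_lt Y
      rw [hj, ← hk] at this
      exact lt_of_mul_lt_mul_left this (Nat.zero_le _)
    · simp only [← hj]; simp

open Classical in
theorem aux_card (q k m : ℕ) [Fact q.Prime] (hm : m ≤ k) (a : ZMod (q ^ k)) :
    (Finset.univ.filter (fun Y : ZMod (q ^ k) => (q : ZMod (q ^ k)) ^ m ∣ Y - a)).card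
      = q ^ (k - m) := by
  rw [← aux_card0 q k m hm]
  refine Finset.card_bij (fun Y _ => Y - a) ?_ ?_ ?_
  · intro Y hY; simpa using hY
  · intro Y _ Z _ h; simpa using h
  · intro Y hY; exact ⟨Y + a, by simpa using hY, by simp⟩

open Classical in
theorem aux_main (q k s : ℕ) [Fact q.Prime] (hq : Odd q) (hs : 2 * s < k) (y : ZMod (q ^ k))
    (h1 : (q : ZMod (q ^ k)) ^ s ∣ y) (h2 : ¬ (q : ZMod (q ^ k)) ^ (s + 1) ∣ y) :
    (Finset.univ.filter (fun Y : ZMod (q ^ k) => Y ^ 2 = y ^ 2)).card = 2 * q ^ s := by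
  have hp : Prime (q : ℤ) := Nat.prime_iff_prime_int.mp Fact.out
  obtain ⟨y, rfl⟩ := ZMod.intCast_surjective y
  rw [aux_dvd _ _ _ (by omega)] at h1 h2
  have h2y : ¬ (q : ℤ) ^ (s + 1) ∣ 2 * y := by
    intro h
    apply h2
    refine hp.pow_dvd_of_dvd_mul_left _ ?_ h
    intro h3
    have h4 : q ∣ 2 := by exact_mod_cast h3
    have := (Nat.prime_dvd_prime_iff_eq Fact.out Nat.prime_two).mp h4
    subst this
    exact absurd hq (by decide)
  have e : (Finset.univ.filter (fun Y : ZMod (q ^ k) => Y ^ 2 = (y : ZMod (q ^ k)) ^ 2))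
      = (Finset.univ.filter (fun Y : ZMod (q ^ k) => (q : ZMod (q ^ k)) ^ (k - s) ∣ Y - y)) ∪
        (Finset.univ.filter (fun Y : ZMod (q ^ k) => (q : ZMod (q ^ k)) ^ (k - s) ∣ Y - (-y))) := by
    ext Y
    obtain ⟨Y, rfl⟩ := ZMod.intCast_surjective Y
    simp only [Finset.mem_union, Finset.mem_filter, Finset.mem_univ, true_and]
    rw [← Int.cast_neg, ← Int.cast_sub, ← Int.cast_sub, aux_dvd _ _ _ (by omega),
      aux_dvd _ _ _ (by omega), ← sub_eq_zero, ← Int.cast_pow, ← Int.cast_pow, ← Int.cast_sub,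
      aux_zero, sub_neg_eq_add]
    have e1 : Y ^ 2 - y ^ 2 = (Y + y) * (Y - y) := by ring
    have e2 : (q : ℤ) ^ k = (q : ℤ) ^ s * (q : ℤ) ^ (k - s) := by
      rw [← pow_add]; congr 1; omega
    have hle : (q : ℤ) ^ s ∣ (q : ℤ) ^ (k - s) := pow_dvd_pow _ (by omega)
    have h1' : (q : ℤ) ^ s ∣ 2 * y := h1.mul_left 2
    constructor
    · intro h
      rw [e1] at h
      by_cases ha : (q : ℤ) ^ (s + 1) ∣ Y + y
      · right
        rw [mul_comm] at h
        refine aux_mul _ hp k s _ _ h ?_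
        intro hb
        apply h2y
        have := dvd_sub ha hb
        rwa [show Y + y - (Y - y) = 2 * y by ring] at this
      · left
        exact aux_mul _ hp k s _ _ h ha
    · rw [e1, e2]
      rintro (h | h)
      · refine mul_dvd_mul ?_ h
        have := dvd_add (hle.trans h) h1'
        rwa [show Y - y + 2 * y = Y + y by ring] at this
      · rw [mul_comm (Y + y)]
        refine mul_dvd_mul ?_ h
        have := dvd_sub (hle.trans h) h1'
        rwa [show Y + y - 2 * y = Y - y by ring] at this
  rw [e, Finset.card_union_of_disjoint, aux_card _ _ _ (by omega), aux_card _ _ _ (by omega),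
    show k - (k - s) = s by omega, two_mul]
  rw [Finset.disjoint_filter]
  intro Y _ ha hb
  obtain ⟨Y, rfl⟩ := ZMod.intCast_surjective Y
  rw [← Int.cast_sub, aux_dvd _ _ _ (by omega)] at ha
  rw [← Int.cast_neg, ← Int.cast_sub, aux_dvd _ _ _ (by omega)] at hb
  apply h2y
  have := (pow_dvd_pow (q : ℤ) (show s + 1 ≤ k - s by omega)).trans (dvd_sub hb ha)
  rwa [show Y - -y - (Y - y) = 2 * y by ring] at this

theorem aux_unit_s6 (q k : ℕ) [Fact q.Prime] (hk : 1 ≤ k) (v : (ZMod (q ^ k))ˣ) :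
    ¬ (q : ZMod (q ^ k)) ∣ v := by
  intro h
  have hu : (q : ZMod (q ^ k)) ^ 1 ∣ ((1 : ℤ) : ZMod (q ^ k)) := by
    rw [pow_one, Int.cast_one]; exact h.trans v.isUnit.dvd
  rw [aux_dvd _ _ _ hk, pow_one] at hu
  have : q ∣ 1 := by exact_mod_cast hu
  exact (Fact.out : q.Prime).one_lt.ne' (Nat.dvd_one.mp this)

theorem aux_sq_s6 (p : ℤ) (hp : Prime p) (m : ℕ) (y : ℤ) : p ^ m ∣ y ^ 2 ↔ p ^ ((m + 1) / 2) ∣ y := by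
  constructor
  · intro h
    by_contra hn
    obtain ⟨r, hr⟩ : ∃ r, (m + 1) / 2 = r + 1 := by
      rcases hh : (m + 1) / 2 with _ | r
      · rw [hh] at hn; simp at hn
      · exact ⟨r, rfl⟩
    rw [hr] at hn
    rw [sq] at h
    have := aux_mul p hp m r y y h hn
    exact hn ((pow_dvd_pow p (by omega)).trans this)
  · intro h
    have := pow_dvd_pow_of_dvd h 2
    rw [← pow_mul] at this
    exact (pow_dvd_pow p (by omega)).trans this

theorem stmt6 (q k : ℕ) [Fact q.Prime] (hq : Odd q) (hk : 1 ≤ k) (b c : ZMod (q ^ k))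
    (N : ℕ)
    (hN : N = (Finset.univ.filter
      (fun X : ZMod (q ^ k) => X ^ 2 + 2 * b * X + c = 0)).card) :
    ((¬ ∃ y : ZMod (q ^ k), y ^ 2 = b ^ 2 - c) → N = 0) ∧
    ((∃ v : (ZMod (q ^ k))ˣ, b ^ 2 - c = (v : ZMod (q ^ k)) ^ 2) → N = 2) ∧
    (b ^ 2 - c = 0 → N = q ^ (k / 2)) ∧
    (∀ t : ℕ, ∀ w : (ZMod (q ^ k))ˣ,
      b ^ 2 - c ≠ 0 → (∃ y : ZMod (q ^ k), y ^ 2 = b ^ 2 - c) →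
      1 ≤ t → t ≤ k - 1 → b ^ 2 - c = (q : ZMod (q ^ k)) ^ t * (w : ZMod (q ^ k)) →
      Even t ∧ N = 2 * q ^ (t / 2)) := by
  classical
  have hp : Prime (q : ℤ) := Nat.prime_iff_prime_int.mp Fact.out
  have hN' : N = (Finset.univ.filter (fun Y : ZMod (q ^ k) => Y ^ 2 = b ^ 2 - c)).card := by
    rw [hN]
    refine Finset.card_bij (fun Y _ => Y + b) ?_ ?_ ?_
    · intro Y hY
      simp only [Finset.mem_filter, Finset.mem_univ, true_and] at hY ⊢
      linear_combination hY
    · intro Y _ Z _ h; simpa using h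
    · intro Y hY
      simp only [Finset.mem_filter, Finset.mem_univ, true_and] at hY
      refine ⟨Y - b, ?_, by simp⟩
      simp only [Finset.mem_filter, Finset.mem_univ, true_and]
      linear_combination hY
  clear hN
  generalize b ^ 2 - c = D at *
  subst hN'
  refine ⟨?_, ?_, ?_, ?_⟩
  · intro h
    rw [Finset.card_eq_zero, Finset.filter_eq_empty_iff]
    intro Y _ hY
    exact h ⟨Y, hY⟩
  · rintro ⟨v, rfl⟩
    have := aux_main q k 0 hq (by omega) (v : ZMod (q ^ k)) (by simp)
      (by simpa using aux_unit_s6 q k hk v)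
    simpa using this
  · rintro rfl
    have := aux_card0 q k ((k + 1) / 2) (by omega)
    rw [show k - (k + 1) / 2 = k / 2 by omega] at this
    rw [← this]
    congr 1
    ext Y
    obtain ⟨Y, rfl⟩ := ZMod.intCast_surjective Y
    simp only [Finset.mem_filter, Finset.mem_univ, true_and]
    rw [aux_dvd _ _ _ (by omega), ← Int.cast_pow, aux_zero, aux_sq_s6 _ hp]
  · rintro t w - ⟨y, hy⟩ ht1 htk hD
    rw [← hy] at hD ⊢
    have hdt : (q : ZMod (q ^ k)) ^ t ∣ y ^ 2 := by rw [hD]; exact Dvd.intro _ rfl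
    have hndt : ¬ (q : ZMod (q ^ k)) ^ (t + 1) ∣ y ^ 2 := by
      obtain ⟨Z, hZ⟩ := ZMod.intCast_surjective (w : ZMod (q ^ k))
      have hw := aux_unit_s6 q k hk w
      rw [← hZ, ← pow_one (q : ZMod (q ^ k)), aux_dvd _ _ _ hk, pow_one] at hw
      rw [hD, ← hZ]
      have e : (q : ZMod (q ^ k)) ^ t * (Z : ZMod (q ^ k)) = (((q : ℤ) ^ t * Z : ℤ) : ZMod (q ^ k)) := by
        push_cast; rfl
      rw [e, aux_dvd _ _ _ (by omega), pow_succ]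
      intro h
      exact hw ((mul_dvd_mul_iff_left (pow_ne_zero t hp.ne_zero)).mp h)
    obtain ⟨y, rfl⟩ := ZMod.intCast_surjective y
    rw [← Int.cast_pow, aux_dvd _ _ _ (by omega), aux_sq_s6 _ hp] at hdt hndt
    have hev : Even t := by
      by_contra ho
      rw [Nat.not_even_iff_odd] at ho
      obtain ⟨r, rfl⟩ := ho
      rw [show (2 * r + 1 + 1 + 1) / 2 = (2 * r + 1 + 1) / 2 by omega] at hndt
      exact hndt hdt
    refine ⟨hev, ?_⟩
    obtain ⟨r, rfl⟩ := hev
    rw [show (r + r + 1) / 2 = r by omega] at hdt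
    rw [show (r + r + 1 + 1) / 2 = r + 1 by omega] at hndt
    rw [show (r + r) / 2 = r by omega]
    have := aux_main q k r hq (by omega) (y : ZMod (q ^ k))
      ((aux_dvd _ _ _ (by omega) _).mpr hdt) (fun h => hndt ((aux_dvd _ _ _ (by omega) _).mp h))
    convert this
end

section
/- Let q be an odd prime, m ≥ 2 an integer, and let d, u ∈ (ZMod (q^m))ˣ be units such that the image of d in ZMod q is not a square. Let c be an integer with 1 ≤ c ≤ q−1 such that c ≢ u·d (mod q) and c ≢ −u·d (mod q). Put S_c = {a ∈ ZMod (q^m) : a ≡ c (mod q)} and, for a ∈ S_c, κ(a) = (u²·d² − d)·(a² − d)⁻¹ − 1 (here a² − d is a unit for every a, and κ(a) = −(a + u·d)·(a − u·d)·(a² − d)⁻¹ is a unit for a ∈ S_c). Then κ restricted to S_c is injective, and κ(S_c) = {y ∈ (ZMod (q^m))ˣ : y ≡ κ(c) (mod q)}; that is, κ(S_c) is a single fiber of the reduction map (ZMod (q^m))ˣ → (ZMod q)ˣ. -/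
theorem isUnit_aux (q m : ℕ) [Fact q.Prime] (hm : m ≠ 0) (x : ZMod (q ^ m)) :
    IsUnit x ↔ ZMod.castHom (dvd_pow_self q hm) (ZMod q) x ≠ 0 := by
  have hp : q.Prime := Fact.out
  haveI : NeZero (q ^ m) := ⟨pow_ne_zero _ hp.ne_zero⟩
  obtain ⟨n, rfl⟩ : ∃ n : ℕ, (n : ZMod (q ^ m)) = x := ⟨x.val, ZMod.natCast_zmod_val x⟩
  rw [map_natCast, Ne, ZMod.natCast_eq_zero_iff, ZMod.isUnit_iff_coprime,
    Nat.coprime_pow_right_iff (Nat.pos_of_ne_zero hm), Nat.coprime_comm,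
    hp.coprime_iff_not_dvd]

theorem stmt7 (q m : ℕ) [Fact q.Prime] (hq : Odd q) (hm : 2 ≤ m)
    (d u : (ZMod (q ^ m))ˣ)
    (hd : ¬ ∃ y : ZMod q,
      y ^ 2 = ZMod.castHom (dvd_pow_self q (by omega : m ≠ 0)) (ZMod q) (d : ZMod (q ^ m)))
    (c : ℕ) (hc1 : 1 ≤ c) (hc2 : c ≤ q - 1)
    (hcu : (c : ZMod q) ≠
      ZMod.castHom (dvd_pow_self q (by omega : m ≠ 0)) (ZMod q)
        ((u : ZMod (q ^ m)) * (d : ZMod (q ^ m))))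
    (hcu' : (c : ZMod q) ≠
      ZMod.castHom (dvd_pow_self q (by omega : m ≠ 0)) (ZMod q)
        (-((u : ZMod (q ^ m)) * (d : ZMod (q ^ m)))))
    (κ : ZMod (q ^ m) → ZMod (q ^ m))
    (hκ : ∀ a : ZMod (q ^ m), κ a =
      ((u : ZMod (q ^ m)) ^ 2 * (d : ZMod (q ^ m)) ^ 2 - (d : ZMod (q ^ m))) *
        (a ^ 2 - (d : ZMod (q ^ m)))⁻¹ - 1)
    (S : Set (ZMod (q ^ m)))
    (hS : S = {a : ZMod (q ^ m) |
      ZMod.castHom (dvd_pow_self q (by omega : m ≠ 0)) (ZMod q) a = (c : ZMod q)}) :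
    Set.InjOn κ S ∧
    κ '' S = {y : ZMod (q ^ m) | IsUnit y ∧
      ZMod.castHom (dvd_pow_self q (by omega : m ≠ 0)) (ZMod q) y =
        ZMod.castHom (dvd_pow_self q (by omega : m ≠ 0)) (ZMod q) (κ (c : ZMod (q ^ m)))} := by
  have hp : q.Prime := Fact.out
  have hm0 : m ≠ 0 := by omega
  haveI : NeZero (q ^ m) := ⟨pow_ne_zero _ hp.ne_zero⟩
  have hU := isUnit_aux q m hm0
  generalize hr : ZMod.castHom (dvd_pow_self q (by omega : m ≠ 0)) (ZMod q) = r at *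
  have hA : IsUnit ((u : ZMod (q ^ m)) ^ 2 * (d : ZMod (q ^ m)) ^ 2 - (d : ZMod (q ^ m))) := by
    rw [hU]
    intro h
    apply hd
    refine ⟨r u * r d, ?_⟩
    simp only [map_sub, map_mul, map_pow] at h
    linear_combination h
  have hB : ∀ a : ZMod (q ^ m), IsUnit (a ^ 2 - (d : ZMod (q ^ m))) := by
    intro a
    rw [hU]
    intro h
    apply hd
    refine ⟨r a, ?_⟩
    simp only [map_sub, map_pow] at h
    linear_combination h
  have hK : ∀ a, (κ a + 1) * (a ^ 2 - (d : ZMod (q ^ m))) =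
      (u : ZMod (q ^ m)) ^ 2 * (d : ZMod (q ^ m)) ^ 2 - (d : ZMod (q ^ m)) := by
    intro a
    rw [hκ, sub_add_cancel, mul_assoc, ZMod.inv_mul_of_unit _ (hB a), mul_one]
  have hc0 : (c : ZMod q) ≠ 0 := by
    rw [Ne, ZMod.natCast_eq_zero_iff]
    intro h
    have := Nat.le_of_dvd hc1 h
    have := hp.pos
    omega
  have h2 : (2 : ZMod q) ≠ 0 := by
    intro h
    have h' : ((2 : ℕ) : ZMod q) = 0 := by exact_mod_cast h
    rw [ZMod.natCast_eq_zero_iff] at h'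
    have := Nat.le_of_dvd two_pos h'
    have := hp.two_le
    have : q = 2 := by omega
    subst this
    exact absurd hq (by decide)
  have hinj : Set.InjOn κ S := by
    intro a ha b hb hab
    rw [hS] at ha hb
    simp only [Set.mem_setOf_eq] at ha hb
    have h1 := hK a
    have h3 := hK b
    rw [hab] at h1
    have hk : IsUnit (κ b + 1) := isUnit_of_mul_isUnit_left (h3 ▸ hA)
    have h4 := hk.mul_left_cancel (h1.trans h3.symm)
    have hs : IsUnit (a + b) := by
      rw [hU, map_add, ha, hb, ← two_mul]
      exact mul_ne_zero h2 hc0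
    have h5 : (a + b) * a = (a + b) * b := by linear_combination h4
    exact hs.mul_left_cancel h5
  have hrK : ∀ a, r a = c → r (κ a) = r (κ (c : ZMod (q ^ m))) := by
    intro a ha
    have h1 := congrArg r (hK a)
    have h3 := congrArg r (hK c)
    have hne := (hU _).1 (hB c)
    simp only [map_sub, map_mul, map_pow, map_add, map_one, map_natCast, ha] at h1 h3 hne
    have := mul_right_cancel₀ hne (h1.trans h3.symm)
    exact add_right_cancel this
  have hKc : r (κ (c : ZMod (q ^ m))) ≠ 0 := by
    intro h
    have h3 := congrArg r (hK c)
    simp only [map_sub, map_mul, map_pow, map_add, map_one, map_natCast, h] at h3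
    rw [map_mul] at hcu
    rw [map_neg, map_mul] at hcu'
    have : ((c : ZMod q) - r u * r d) * (c - -(r u * r d)) = 0 := by linear_combination h3
    rcases mul_eq_zero.1 this with h | h
    · exact hcu (sub_eq_zero.1 h)
    · exact hcu' (sub_eq_zero.1 h)
  refine ⟨hinj, ?_⟩
  apply Set.eq_of_subset_of_ncard_le _ _ (Set.toFinite _)
  · rintro _ ⟨a, ha, rfl⟩
    rw [hS] at ha
    have h := hrK a ha
    exact ⟨(hU _).2 (h ▸ hKc), h⟩
  · rw [Set.ncard_image_of_injOn hinj]
    apply Set.ncard_le_ncard_of_injOn (fun y => y - κ c + c) _ _ (Set.toFinite _)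
    · rintro y ⟨-, hy⟩
      rw [hS]
      simp [hy]
    · intro x _ y _ h
      simpa using h
end

section
/- Let q be an odd prime, t ≥ 1 and m ≥ 2t+2 integers, and let d, u ∈ (ZMod (q^m))ˣ be units such that the image of d in ZMod q is not a square. For an integer r with 1 ≤ r ≤ q−1 put S_{t,r} = {q^t·w : w ∈ (ZMod (q^m))ˣ, w ≡ r (mod q)} ⊆ ZMod (q^m), and define κ_t(a) = (u²·d² − d)·(a² − d)⁻¹ − 1 (the element a² − d is a unit for every a). Then: (a) κ_t(S_{t,r}) = {y ∈ (ZMod (q^m))ˣ : y ≡ κ_t(q^t·r) (mod q^(2t+1))}, i.e., the image is a single fiber of the reduction map (ZMod (q^m))ˣ → (ZMod (q^(2t+1)))ˣ; (b) every nonempty fiber of the restriction of κ_t to S_{t,r} has exactly q^t elements. -/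
theorem aux_cast_s8 (q m j : ℕ) [Fact q.Prime] (hj : q ^ j ∣ q ^ m) (x : ZMod (q ^ m)) :
    ZMod.castHom hj (ZMod (q ^ j)) x = 0 ↔ (q : ZMod (q ^ m)) ^ j ∣ x := by
  have hp : q.Prime := Fact.out
  have : NeZero (q ^ m) := ⟨pow_ne_zero _ hp.ne_zero⟩
  constructor
  · intro h
    rw [← ZMod.natCast_zmod_val x, map_natCast, ZMod.natCast_eq_zero_iff] at h
    obtain ⟨k, hk⟩ := h
    refine ⟨k, ?_⟩
    rw [← ZMod.natCast_zmod_val x, hk]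
    push_cast; rfl
  · rintro ⟨k, rfl⟩
    rw [map_mul, map_pow, map_natCast]
    have : ((q : ZMod (q ^ j))) ^ j = 0 := by
      have := ZMod.natCast_self (q ^ j)
      exact_mod_cast this
    rw [this, zero_mul]

theorem aux_cast1 (q m : ℕ) [Fact q.Prime] (hj : q ∣ q ^ m) (x : ZMod (q ^ m)) :
    ZMod.castHom hj (ZMod q) x = 0 ↔ (q : ZMod (q ^ m)) ∣ x := by
  have hp : q.Prime := Fact.out
  have : NeZero (q ^ m) := ⟨pow_ne_zero _ hp.ne_zero⟩
  constructor
  · intro h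
    rw [← ZMod.natCast_zmod_val x, map_natCast, ZMod.natCast_eq_zero_iff] at h
    obtain ⟨k, hk⟩ := h
    refine ⟨k, ?_⟩
    rw [← ZMod.natCast_zmod_val x, hk]
    push_cast; rfl
  · rintro ⟨k, rfl⟩
    rw [map_mul, map_natCast, ZMod.natCast_self, zero_mul]

theorem aux_unit_s8 (q m : ℕ) [Fact q.Prime] (x : ZMod (q ^ m))
    (h : ¬ (q : ZMod (q ^ m)) ∣ x) : IsUnit x := by
  have hp : q.Prime := Fact.out
  have : NeZero (q ^ m) := ⟨pow_ne_zero _ hp.ne_zero⟩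
  rw [← ZMod.natCast_zmod_val x, ZMod.isUnit_iff_coprime]
  apply Nat.Coprime.pow_right
  rw [Nat.coprime_comm, hp.coprime_iff_not_dvd]
  rintro ⟨k, hk⟩
  apply h
  refine ⟨k, ?_⟩
  rw [← ZMod.natCast_zmod_val x, hk]
  push_cast; rfl

theorem aux_nonunit_s8 (q m : ℕ) [Fact q.Prime] (hm : m ≠ 0) :
    ¬ IsUnit (q : ZMod (q ^ m)) := by
  have hp : q.Prime := Fact.out
  rw [ZMod.isUnit_iff_coprime, Nat.coprime_pow_right_iff (Nat.pos_of_ne_zero hm), Nat.coprime_self]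
  exact hp.one_lt.ne'

theorem aux_ann (q m i : ℕ) [Fact q.Prime] (hi : i ≤ m) (x : ZMod (q ^ m))
    (h : (q : ZMod (q ^ m)) ^ i * x = 0) : (q : ZMod (q ^ m)) ^ (m - i) ∣ x := by
  have hp : q.Prime := Fact.out
  have : NeZero (q ^ m) := ⟨pow_ne_zero _ hp.ne_zero⟩
  have h2 : ((q ^ i * x.val : ℕ) : ZMod (q ^ m)) = 0 := by
    push_cast; rw [ZMod.natCast_zmod_val x]; exact h
  rw [ZMod.natCast_eq_zero_iff] at h2
  obtain ⟨j, rfl⟩ := Nat.exists_eq_add_of_le hi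
  have h3 : q ^ i * q ^ j ∣ q ^ i * x.val := (pow_add q i j) ▸ h2
  obtain ⟨k, hk⟩ := Nat.dvd_of_mul_dvd_mul_left (pow_pos hp.pos i) h3
  refine ⟨k, ?_⟩
  rw [← ZMod.natCast_zmod_val x, hk, Nat.add_sub_cancel_left]
  push_cast; rfl

theorem aux_hensel (q m : ℕ) [Fact q.Prime] (x r v : ZMod (q ^ m))
    (h2r : ∀ w : ZMod (q ^ m), (q : ZMod (q ^ m)) ∣ w - r → IsUnit (2 * w))
    (hv : (q : ZMod (q ^ m)) ∣ r ^ 2 - v) :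
    ∃ w, (q : ZMod (q ^ m)) ∣ w - r ∧ w ^ 2 = v := by
  have key : ∀ j : ℕ, ∃ w, (q : ZMod (q ^ m)) ∣ w - r ∧ (q : ZMod (q ^ m)) ^ (j + 1) ∣ w ^ 2 - v := by
    intro j
    induction j with
    | zero => exact ⟨r, by simp, by simpa using hv⟩
    | succ j ih =>
      obtain ⟨w, hw, e, he⟩ := ih
      obtain ⟨c, hc⟩ := (h2r w hw).exists_right_inv
      refine ⟨w + (q : ZMod (q ^ m)) ^ (j + 1) * (- e * c), ?_, ?_⟩
      · rw [add_sub_right_comm]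
        exact dvd_add hw (Dvd.dvd.mul_right (dvd_pow_self _ (by omega)) _)
      · refine ⟨(q : ZMod (q ^ m)) ^ j * (e * c) ^ 2, ?_⟩
        linear_combination he - (q : ZMod (q ^ m)) ^ (j + 1) * e * hc
  obtain ⟨w, hw, h⟩ := key m
  refine ⟨w, hw, ?_⟩
  have h0 : (q : ZMod (q ^ m)) ^ m = 0 := by
    have := ZMod.natCast_self (q ^ m)
    exact_mod_cast this
  rw [pow_succ, h0, zero_mul, zero_dvd_iff] at h
  exact sub_eq_zero.mp h

theorem aux_card_s8 (q m t : ℕ) [Fact q.Prime] (ht : t ≤ m) (a : ZMod (q ^ m)) :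
    ({b | (q : ZMod (q ^ m)) ^ (m - t) ∣ b - a} : Set (ZMod (q ^ m))).ncard = q ^ t := by
  have hp : q.Prime := Fact.out
  have : NeZero (q ^ m) := ⟨pow_ne_zero _ hp.ne_zero⟩
  have h0 : (q : ZMod (q ^ m)) ^ m = 0 := by
    have := ZMod.natCast_self (q ^ m)
    exact_mod_cast this
  obtain ⟨s, rfl⟩ := Nat.exists_eq_add_of_le' ht
  rw [Nat.add_sub_cancel]
  have : ({b | (q : ZMod (q ^ (s + t))) ^ s ∣ b - a} : Set (ZMod (q ^ (s + t)))) =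
      (fun k : ℕ => a + (q : ZMod (q ^ (s + t))) ^ s * k) '' (Finset.range (q ^ t) : Set ℕ) := by
    ext b
    simp only [Set.mem_setOf_eq, Set.mem_image, Finset.coe_range, Set.mem_Iio]
    constructor
    · rintro ⟨k, hk⟩
      refine ⟨k.val % q ^ t, Nat.mod_lt _ (pow_pos hp.pos _), ?_⟩
      have h1 := congrArg (Nat.cast : ℕ → ZMod (q ^ (s + t))) (Nat.div_add_mod k.val (q ^ t))
      rw [ZMod.natCast_zmod_val k] at h1
      push_cast at h1
      have h0 : (q : ZMod (q ^ (s + t))) ^ s * (q : ZMod (q ^ (s + t))) ^ t = 0 := by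
        rw [← pow_add]; exact h0
      push_cast
      linear_combination (q : ZMod (q ^ (s + t))) ^ s * h1 - hk - h0 * ((k.val / q ^ t : ℕ) : ZMod (q ^ (s + t)))
    · rintro ⟨k, _, rfl⟩
      exact ⟨k, by ring⟩
  rw [this, Set.ncard_image_of_injOn, Set.ncard_coe_finset, Finset.card_range]
  intro k hk l hl h
  simp only [Finset.coe_range, Set.mem_Iio] at hk hl
  have h1 : ((q ^ s * k : ℕ) : ZMod (q ^ (s + t))) = ((q ^ s * l : ℕ) : ZMod (q ^ (s + t))) := by
    push_cast; exact add_left_cancel h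
  rw [ZMod.natCast_eq_natCast_iff', pow_add, Nat.mul_mod_mul_left, Nat.mul_mod_mul_left,
    Nat.mod_eq_of_lt hk, Nat.mod_eq_of_lt hl] at h1
  exact Nat.eq_of_mul_eq_mul_left (pow_pos hp.pos s) h1

theorem stmt8 (q m t : ℕ) [Fact q.Prime] (hq : Odd q) (ht : 1 ≤ t) (hm : 2 * t + 2 ≤ m)
    (d u : (ZMod (q ^ m))ˣ)
    (hd : ¬ ∃ y : ZMod q,
      y ^ 2 = ZMod.castHom (dvd_pow_self q (by omega : m ≠ 0)) (ZMod q) (d : ZMod (q ^ m)))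
    (r : ℕ) (hr1 : 1 ≤ r) (hr2 : r ≤ q - 1)
    (κ : ZMod (q ^ m) → ZMod (q ^ m))
    (hκ : ∀ a : ZMod (q ^ m), κ a =
      ((u : ZMod (q ^ m)) ^ 2 * (d : ZMod (q ^ m)) ^ 2 - (d : ZMod (q ^ m))) *
        (a ^ 2 - (d : ZMod (q ^ m)))⁻¹ - 1)
    (S : Set (ZMod (q ^ m)))
    (hS : S = {x : ZMod (q ^ m) | ∃ w : (ZMod (q ^ m))ˣ,
      ZMod.castHom (dvd_pow_self q (by omega : m ≠ 0)) (ZMod q) (w : ZMod (q ^ m)) =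
        (r : ZMod q) ∧
      x = (q : ZMod (q ^ m)) ^ t * (w : ZMod (q ^ m))}) :
    κ '' S = {y : ZMod (q ^ m) | IsUnit y ∧
      ZMod.castHom (pow_dvd_pow q (by omega : 2 * t + 1 ≤ m)) (ZMod (q ^ (2 * t + 1))) y =
        ZMod.castHom (pow_dvd_pow q (by omega : 2 * t + 1 ≤ m)) (ZMod (q ^ (2 * t + 1)))
          (κ ((q : ZMod (q ^ m)) ^ t * (r : ZMod (q ^ m))))} ∧
    ∀ y : ZMod (q ^ m), (∃ a ∈ S, κ a = y) →
      ({a ∈ S | κ a = y} : Set (ZMod (q ^ m))).ncard = q ^ t := by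
  have hp : q.Prime := Fact.out
  have hm0 : m ≠ 0 := by omega
  have hQ := aux_nonunit_s8 q m hm0
  have hnu : ∀ x : ZMod (q ^ m), IsUnit x → ¬ (q : ZMod (q ^ m)) ∣ x :=
    fun x hx h => hQ (isUnit_of_dvd_unit h hx)
  have hadd : ∀ x y : ZMod (q ^ m), IsUnit x → (q : ZMod (q ^ m)) ∣ y - x → IsUnit y := by
    intro x y hx h
    apply aux_unit_s8
    intro hy
    exact hnu x hx (by simpa using dvd_sub hy h)
  have hru : IsUnit (r : ZMod (q ^ m)) := by
    rw [ZMod.isUnit_iff_coprime]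
    apply Nat.Coprime.pow_right
    rw [Nat.coprime_comm, hp.coprime_iff_not_dvd]
    intro h
    have := Nat.le_of_dvd hr1 h
    have := hp.one_lt
    omega
  have h2u : IsUnit (2 : ZMod (q ^ m)) := by
    have : IsUnit ((2 : ℕ) : ZMod (q ^ m)) := by
      rw [ZMod.isUnit_iff_coprime]
      apply Nat.Coprime.pow_right
      exact (Nat.coprime_two_left).mpr hq
    exact_mod_cast this
  have h2r : ∀ w : ZMod (q ^ m), (q : ZMod (q ^ m)) ∣ w - r → IsUnit (2 * w) :=
    fun w hw => h2u.mul (hadd _ _ hru hw)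
  have hSm : ∀ x, x ∈ S ↔ ∃ w : ZMod (q ^ m), (q : ZMod (q ^ m)) ∣ w - r ∧
      x = (q : ZMod (q ^ m)) ^ t * w := by
    intro x
    rw [hS]
    constructor
    · rintro ⟨w, hw, rfl⟩
      refine ⟨w, ?_, rfl⟩
      rw [← aux_cast1 q m (dvd_pow_self q hm0), map_sub, hw, map_natCast, sub_self]
    · rintro ⟨w, hw, rfl⟩
      obtain ⟨w', rfl⟩ := hadd _ _ hru hw
      refine ⟨w', ?_, rfl⟩
      rw [← aux_cast1 q m (dvd_pow_self q hm0), map_sub, map_natCast, sub_eq_zero] at hw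
      exact hw
  have hCu : IsUnit ((u : ZMod (q ^ m)) ^ 2 * (d : ZMod (q ^ m)) ^ 2 - (d : ZMod (q ^ m))) := by
    have : IsUnit (((u : ZMod (q ^ m)) * d) ^ 2 - (d : ZMod (q ^ m))) := by
      apply aux_unit_s8
      intro h
      rw [← aux_cast1 q m (dvd_pow_self q hm0), map_sub, map_pow, sub_eq_zero] at h
      exact hd ⟨_, h⟩
    rwa [mul_pow] at this
  have hau : ∀ a : ZMod (q ^ m), IsUnit (a ^ 2 - (d : ZMod (q ^ m))) := by
    intro a
    apply aux_unit_s8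
    intro h
    rw [← aux_cast1 q m (dvd_pow_self q hm0), map_sub, map_pow, sub_eq_zero] at h
    exact hd ⟨_, h⟩
  generalize hC : (u : ZMod (q ^ m)) ^ 2 * (d : ZMod (q ^ m)) ^ 2 - (d : ZMod (q ^ m)) = C at *
  have hk : ∀ a, (κ a + 1) * (a ^ 2 - (d : ZMod (q ^ m))) = C := by
    intro a
    rw [hκ, sub_add_cancel, mul_assoc, ZMod.inv_mul_of_unit _ (hau a), mul_one]
  have hk' : ∀ a y, (y + 1) * (a ^ 2 - (d : ZMod (q ^ m))) = C → κ a = y := by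
    intro a y h
    have := (hau a).mul_right_cancel ((hk a).trans h.symm)
    exact add_right_cancel this
  have hk1u : ∀ a, IsUnit (κ a + 1) := fun a =>
    isUnit_of_mul_isUnit_left (by rw [hk a]; exact hCu)
  have hkeq : ∀ a b, κ a = κ b ↔ a ^ 2 = b ^ 2 := by
    intro a b
    constructor
    · intro h
      have h1 := hk a
      rw [h, ← hk b] at h1
      have := (hk1u b).mul_left_cancel h1
      exact sub_left_injective this
    · intro h
      apply hk'
      rw [h, hk b]
  refine ⟨?_, ?_⟩
  · ext y
    simp only [Set.mem_image, Set.mem_setOf_eq]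
    rw [← sub_eq_zero, ← map_sub, aux_cast_s8 q m (2 * t + 1)]
    have hb := hk ((q : ZMod (q ^ m)) ^ t * r)
    have hbu := hau ((q : ZMod (q ^ m)) ^ t * r)
    have hb1 := hk1u ((q : ZMod (q ^ m)) ^ t * r)
    generalize hB : κ ((q : ZMod (q ^ m)) ^ t * r) = B at *
    constructor
    · rintro ⟨a, ha, rfl⟩
      obtain ⟨w, ⟨k, hw⟩, rfl⟩ := (hSm a).1 ha
      have haa := hk ((q : ZMod (q ^ m)) ^ t * w)
      have hA := hau ((q : ZMod (q ^ m)) ^ t * w)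
      generalize κ ((q : ZMod (q ^ m)) ^ t * w) = A at *
      constructor
      · apply isUnit_of_mul_isUnit_left (y := ((q : ZMod (q ^ m)) ^ t * w) ^ 2 - (d : ZMod (q ^ m)))
        refine hadd ((u : ZMod (q ^ m)) ^ 2 * (d : ZMod (q ^ m)) ^ 2) _
          ((u.isUnit.pow 2).mul (d.isUnit.pow 2)) ?_
        have : A * (((q : ZMod (q ^ m)) ^ t * w) ^ 2 - (d : ZMod (q ^ m))) -
            (u : ZMod (q ^ m)) ^ 2 * (d : ZMod (q ^ m)) ^ 2 =
            - ((q : ZMod (q ^ m)) ^ t * w ) ^ 2 := by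
          linear_combination haa - hC
        rw [this]
        exact (((dvd_pow_self _ (by omega)).mul_right w).trans (dvd_pow_self _ two_ne_zero)).neg_right
      · obtain ⟨c, hc⟩ := hA.exists_right_inv
        have e : A - B = (B + 1) * ((q : ZMod (q ^ m)) ^ t * r) ^ 2 * c
            - (B + 1) * ((q : ZMod (q ^ m)) ^ t * w) ^ 2 * c := by
          linear_combination c * haa - c * hb - (A - B) * hc
        rw [e]
        refine ⟨-(B + 1) * c * (k * (w + r)), ?_⟩
        linear_combination -(B + 1) * c * (q : ZMod (q ^ m)) ^ (2 * t) * (w + r) * hw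
    · rintro ⟨-, k, hy⟩
      have hyu : IsUnit (y + 1) := hadd _ _ hb1
        ⟨(q : ZMod (q ^ m)) ^ (2 * t) * k, by linear_combination hy⟩
      obtain ⟨c, hc⟩ := hyu.exists_right_inv
      obtain ⟨w, hw, hw2⟩ := aux_hensel q m 0 (r : ZMod (q ^ m))
        ((r : ZMod (q ^ m)) ^ 2 - q * (k * c * (((q : ZMod (q ^ m)) ^ t * r) ^ 2 - d))) h2r
        ⟨k * c * (((q : ZMod (q ^ m)) ^ t * r) ^ 2 - d), by ring⟩
      refine ⟨_, (hSm _).2 ⟨w, hw, rfl⟩, hk' _ _ ?_⟩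
      linear_combination (y + 1) * (q : ZMod (q ^ m)) ^ (2 * t) * hw2 + hb + hy * (((q : ZMod (q ^ m)) ^ t * r) ^ 2 - d) - (q : ZMod (q ^ m)) ^ (2 * t + 1) * k * (((q : ZMod (q ^ m)) ^ t * r) ^ 2 - d) * hc
  · rintro y ⟨a, ha, rfl⟩
    rw [← aux_card_s8 q m t (by omega) a]
    congr 1
    ext b
    simp only [Set.mem_setOf_eq]
    obtain ⟨w, ⟨k, hw⟩, rfl⟩ := (hSm a).1 ha
    have h0 : (q : ZMod (q ^ m)) ^ m = 0 := by
      have := ZMod.natCast_self (q ^ m)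
      exact_mod_cast this
    rw [hkeq, hSm]
    constructor
    · rintro ⟨⟨v, ⟨l, hv⟩, rfl⟩, h⟩
      have hs : IsUnit (v + w) := hadd (2 * r) _ (h2u.mul hru)
        ⟨k + l, by linear_combination hv + hw⟩
      have h1 : (q : ZMod (q ^ m)) ^ (2 * t) * ((v - w) * (v + w)) = 0 := by
        linear_combination h
      have h2 := aux_ann q m (2 * t) (by omega) _ h1
      rw [hs.dvd_mul_right] at h2
      rw [← mul_sub, show m - t = t + (m - 2 * t) by omega, pow_add]
      exact mul_dvd_mul_left _ h2
    · rintro ⟨x, hx⟩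
      rw [show m - t = t + ((m - 2 * t - 1) + 1) by omega] at hx
      have h0 : (q : ZMod (q ^ m)) ^ (2 * t + ((m - 2 * t - 1) + 1)) = 0 := by
        rw [show 2 * t + ((m - 2 * t - 1) + 1) = m by omega]; exact h0
      refine ⟨⟨w + (q : ZMod (q ^ m)) ^ ((m - 2 * t - 1) + 1) * x,
        ⟨k + (q : ZMod (q ^ m)) ^ (m - 2 * t - 1) * x, by linear_combination hw⟩,
        by linear_combination hx⟩, ?_⟩
      have : b = (q : ZMod (q ^ m)) ^ t * (w + (q : ZMod (q ^ m)) ^ ((m - 2 * t - 1) + 1) * x) := by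
        linear_combination hx
      rw [this]
      linear_combination h0 * (2 * w * x + (q : ZMod (q ^ m)) ^ ((m - 2 * t - 1) + 1) * x ^ 2)
end

section
/- Let q be an odd prime, m ≥ 2 an integer, and χ a primitive Dirichlet character modulo q^m. Then χ² is also a primitive Dirichlet character modulo q^m, and G(χ)² = G(χ²)·J(χ,χ); consequently G(χ)²·G(χ⁻²) = q^m·J(χ,χ). -/
lemma s9_dvd (q m : ℕ) [Fact q.Prime] (u : ZMod (q ^ m))
    (hu : ZMod.castHom (pow_dvd_pow q (Nat.sub_le m 1)) (ZMod (q ^ (m - 1))) u = 1) :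
    ∃ c : ZMod (q ^ m), u = 1 + (q : ZMod (q ^ m)) ^ (m - 1) * c := by
  obtain ⟨k, rfl⟩ := ZMod.natCast_zmod_surjective u
  have h2 : (((k : ℤ) - 1 : ℤ) : ZMod (q ^ (m - 1))) = 0 := by
    rw [map_natCast] at hu
    push_cast
    rw [hu, sub_self]
  rw [ZMod.intCast_zmod_eq_zero_iff_dvd] at h2
  obtain ⟨c, hc⟩ := h2
  refine ⟨(c : ZMod (q ^ m)), ?_⟩
  have := congrArg (Int.cast : ℤ → ZMod (q ^ m)) hc
  push_cast at this
  rw [← this]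
  ring

lemma s9_qm (q m : ℕ) : (q : ZMod (q ^ m)) ^ m = 0 := by
  have := ZMod.natCast_self (q ^ m)
  push_cast at this
  exact this

lemma s9_nonunit (q m : ℕ) [Fact q.Prime] (hm : 1 ≤ m) (u t : ZMod (q ^ m))
    (hu : ZMod.castHom (pow_dvd_pow q (Nat.sub_le m 1)) (ZMod (q ^ (m - 1))) u = 1)
    (ht : ¬ IsUnit t) : u * t = t := by
  obtain ⟨c, rfl⟩ := s9_dvd q m u hu
  obtain ⟨k, rfl⟩ := ZMod.natCast_zmod_surjective t
  rw [ZMod.isUnit_iff_coprime] at ht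
  have hq : q.Prime := Fact.out
  have hd : q ∣ k := by
    by_contra h
    exact ht (Nat.Coprime.pow_right _ ((Nat.Prime.coprime_iff_not_dvd hq).2 h).symm)
  obtain ⟨d, rfl⟩ := hd
  have h0 := s9_qm q m
  obtain ⟨n, rfl⟩ : ∃ n, m = n + 1 := ⟨m - 1, by omega⟩
  simp only [Nat.add_sub_cancel] at *
  push_cast
  linear_combination c * d * h0

lemma s9_pow (q m : ℕ) [Fact q.Prime] (hm : 2 ≤ m) (u : ZMod (q ^ m))
    (hu : ZMod.castHom (pow_dvd_pow q (Nat.sub_le m 1)) (ZMod (q ^ (m - 1))) u = 1) :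
    u ^ q = 1 := by
  have hq : q.Prime := Fact.out
  have hnu : ¬ IsUnit (q : ZMod (q ^ m)) := by
    rw [ZMod.isUnit_iff_coprime]
    intro h
    have := Nat.Coprime.eq_one_of_dvd h (dvd_pow_self q (by omega))
    exact hq.one_lt.ne' this
  have h1 := s9_nonunit q m (by omega) u _ hu hnu
  have h2 := s9_dvd q m u hu
  obtain ⟨c, hc⟩ := h2
  have h3 : u * (u - 1) = u - 1 := by
    obtain ⟨n, rfl⟩ : ∃ n, m = n + 2 := ⟨m - 2, by omega⟩
    have : n + 2 - 1 = n + 1 := by omega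
    rw [this] at hc
    rw [sub_eq_of_eq_add' hc]
    linear_combination (q : ZMod (q ^ (n + 2))) ^ n * c * h1
  have h4 : ∀ n : ℕ, u ^ n = 1 + n * (u - 1) := by
    intro n
    induction n with
    | zero => simp
    | succ n ih =>
      rw [pow_succ, ih]
      push_cast
      linear_combination n * h3
  rw [h4]
  linear_combination h1

lemma s9_sq (q m : ℕ) [Fact q.Prime] (hq : Odd q) (hm : 2 ≤ m)
    (χ : DirichletCharacter ℂ (q ^ m)) (hχ : IsPrim q m χ) : IsPrim q m (χ ^ 2) := by
  obtain ⟨u, hu, hne⟩ := hχ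
  refine ⟨u, hu, fun h => hne ?_⟩
  rw [MulChar.pow_apply_coe] at h
  have h1 : χ (u : ZMod (q ^ m)) ^ q = 1 := by
    rw [← map_pow, s9_pow q m hm _ hu, map_one]
  obtain ⟨k, rfl⟩ := hq
  rw [pow_succ, pow_mul, h, one_pow, one_mul] at h1
  exact h1

lemma s9_prim (q m : ℕ) [Fact q.Prime] (χ : DirichletCharacter ℂ (q ^ m))
    (hχ : IsPrim q m χ) : χ.IsPrimitive := by
  obtain ⟨u, hu, hne⟩ := hχ
  rw [DirichletCharacter.isPrimitive_def]
  obtain ⟨k, hk, hc⟩ := (Nat.dvd_prime_pow Fact.out).1 χ.conductor_dvd_level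
  by_contra hcon
  have hkm : k ≤ m - 1 := by
    have : k ≠ m := by
      rintro rfl
      exact hcon hc
    omega
  have hf : χ.FactorsThrough (q ^ (m - 1)) :=
    χ.factorsThrough_conductor.mono χ (hc ▸ pow_dvd_pow q hkm) (pow_dvd_pow q (Nat.sub_le m 1))
  rw [DirichletCharacter.factorsThrough_iff_ker_unitsMap (pow_dvd_pow q (Nat.sub_le m 1))] at hf
  have hmem : u ∈ (ZMod.unitsMap (pow_dvd_pow q (Nat.sub_le m 1))).ker := by
    rw [MonoidHom.mem_ker]
    ext
    simpa [ZMod.unitsMap_def] using hu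
  have := hf hmem
  rw [MonoidHom.mem_ker, Units.ext_iff, MulChar.coe_toUnitHom] at this
  exact hne this

lemma s9_gauss (n : ℕ) [NeZero n] (χ : DirichletCharacter ℂ n) :
    gaussS n χ = gaussSum χ ZMod.stdAddChar := by
  unfold gaussS gaussSum stdAddChar'
  refine Finset.sum_congr rfl fun a _ => ?_
  rw [ZMod.stdAddChar_apply, ZMod.toCircle_apply]

lemma s9_inv (n : ℕ) [NeZero n] (ψ : DirichletCharacter ℂ n) (hψ : ψ.IsPrimitive) :
    gaussSum ψ ZMod.stdAddChar * gaussSum ψ⁻¹ ZMod.stdAddChar = n * ψ (-1) := by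
  have h : ∀ a : ZMod n, ψ⁻¹ a * ZMod.stdAddChar a * gaussSum ψ ZMod.stdAddChar
      = ∑ x, ψ x * ZMod.stdAddChar (a * (x + 1)) := by
    intro a
    rw [mul_right_comm, ← gaussSum_mulShift_of_isPrimitive _ hψ, gaussSum, Finset.sum_mul]
    refine Finset.sum_congr rfl fun x _ => ?_
    rw [AddChar.mulShift_apply, mul_add, mul_one, AddChar.map_add_eq_mul, mul_assoc]
  rw [mul_comm]
  conv_lhs => rw [gaussSum, Finset.sum_mul]
  rw [Finset.sum_congr rfl fun a _ => h a, Finset.sum_comm]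
  simp_rw [← Finset.mul_sum, AddChar.sum_mulShift _ (ZMod.isPrimitive_stdAddChar n),
    add_eq_zero_iff_eq_neg]
  simp [mul_comm]

lemma s9_jac (q m : ℕ) [Fact q.Prime] (hm : 1 ≤ m)
    (χ : DirichletCharacter ℂ (q ^ m)) (hχ : IsPrim q m (χ ^ 2)) (t : ZMod (q ^ m)) :
    ∑ x, χ x * χ (t - x) = (χ ^ 2) t * jacobiS (q ^ m) χ χ := by
  by_cases ht : IsUnit t
  · obtain ⟨v, rfl⟩ := ht
    rw [jacobiS, Finset.mul_sum, MulChar.pow_apply_coe]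
    symm
    refine Fintype.sum_bijective _ v.mulLeft_bijective _ _ fun x => ?_
    have : (v : ZMod (q ^ m)) - v * x = v * (1 - x) := by ring
    rw [this, map_mul, map_mul]
    ring
  · rw [MulChar.map_nonunit _ ht, zero_mul]
    obtain ⟨u, hu, hne⟩ := hχ
    rw [MulChar.pow_apply_coe] at hne
    have h : χ (u : ZMod (q ^ m)) ^ 2 * ∑ x, χ x * χ (t - x) = ∑ x, χ x * χ (t - x) := by
      rw [Finset.mul_sum]
      refine Fintype.sum_bijective _ u.mulLeft_bijective _ _ fun x => ?_
      have : t - u * x = u * (t - x) := by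
        linear_combination - s9_nonunit q m hm u t hu ht
      rw [this, map_mul, map_mul]
      ring
    have h2 : (χ (u : ZMod (q ^ m)) ^ 2 - 1) * ∑ x, χ x * χ (t - x) = 0 := by
      linear_combination h
    exact (mul_eq_zero.1 h2).resolve_left (sub_ne_zero.2 hne)

theorem stmt9 (q m : ℕ) [Fact q.Prime] (hq : Odd q) (hm : 2 ≤ m)
    (χ : DirichletCharacter ℂ (q ^ m)) (hχ : IsPrim q m χ) :
    IsPrim q m (χ ^ 2) ∧
    gaussS (q ^ m) χ ^ 2 = gaussS (q ^ m) (χ ^ 2) * jacobiS (q ^ m) χ χ ∧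
    gaussS (q ^ m) χ ^ 2 * gaussS (q ^ m) ((χ ^ 2)⁻¹) = (q : ℂ) ^ m * jacobiS (q ^ m) χ χ := by
  have h1 := s9_sq q m hq hm χ hχ
  have h2 : gaussS (q ^ m) χ ^ 2 = gaussS (q ^ m) (χ ^ 2) * jacobiS (q ^ m) χ χ := by
    rw [s9_gauss, s9_gauss, sq, gaussSum_mul]
    simp_rw [← Finset.sum_mul, s9_jac q m (by omega) χ h1]
    rw [gaussSum, Finset.sum_mul]
    exact Finset.sum_congr rfl fun a _ => by ring
  refine ⟨h1, h2, ?_⟩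
  have h3 := s9_inv (q ^ m) (χ ^ 2) (s9_prim q m _ h1)
  have h4 : (χ ^ 2) (-1) = 1 := by
    rw [MulChar.pow_apply' _ two_ne_zero, ← map_pow]
    simp
  rw [h4, ← s9_gauss, ← s9_gauss] at h3
  push_cast at h3
  rw [h2]
  linear_combination jacobiS (q ^ m) χ χ * h3
end

section
/- Let q be an odd prime, n ≥ 1 and r ≥ 1 integers, and c, e ∈ (ZMod (q^n))ˣ. Then for every v ∈ (ZMod (q^n))ˣ, the elements q^r·v − c and q^r·v·(q^r·v − c) + e are units of ZMod (q^n), and the map δ : (ZMod (q^n))ˣ → (ZMod (q^n))ˣ defined by δ(v) = −v·(q^r·v − c)·(q^r·v·(q^r·v − c) + e)⁻¹ is a bijection. -/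
theorem stmt16 (q n r : ℕ) [Fact q.Prime] (hq : Odd q) (hn : 1 ≤ n) (hr : 1 ≤ r)
    (c e : (ZMod (q ^ n))ˣ)
    (δ : ZMod (q ^ n) → ZMod (q ^ n))
    (hδ : ∀ x : ZMod (q ^ n), δ x =
      -x * ((q : ZMod (q ^ n)) ^ r * x - (c : ZMod (q ^ n))) *
        ((q : ZMod (q ^ n)) ^ r * x * ((q : ZMod (q ^ n)) ^ r * x - (c : ZMod (q ^ n))) +
          (e : ZMod (q ^ n)))⁻¹) :
    (∀ v : (ZMod (q ^ n))ˣ,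
      IsUnit ((q : ZMod (q ^ n)) ^ r * (v : ZMod (q ^ n)) - (c : ZMod (q ^ n))) ∧
      IsUnit ((q : ZMod (q ^ n)) ^ r * (v : ZMod (q ^ n)) *
          ((q : ZMod (q ^ n)) ^ r * (v : ZMod (q ^ n)) - (c : ZMod (q ^ n))) +
        (e : ZMod (q ^ n)))) ∧
    Set.BijOn δ {x : ZMod (q ^ n) | IsUnit x} {x : ZMod (q ^ n) | IsUnit x} := by
  have hq0 : q ≠ 0 := (Fact.out : q.Prime).ne_zero
  haveI : NeZero (q ^ n) := ⟨pow_ne_zero n hq0⟩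
  have ht : IsNilpotent ((q : ZMod (q ^ n)) ^ r) := by
    refine ⟨n, ?_⟩
    rw [← pow_mul, mul_comm, pow_mul]
    have : ((q : ZMod (q ^ n)) ^ n) = 0 := by
      have h := ZMod.natCast_self (q ^ n)
      rwa [Nat.cast_pow] at h
    rw [this, zero_pow (by omega)]
  generalize (q : ZMod (q ^ n)) ^ r = t at *
  have key : ∀ (y : ZMod (q ^ n)) (u : (ZMod (q ^ n))ˣ), IsUnit (t * y + (u : ZMod (q ^ n))) := by
    intro y u
    have h1 : IsNilpotent (t * y) := (Commute.all t y).isNilpotent_mul_right ht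
    exact h1.isUnit_add_right_of_commute u.isUnit (Commute.all _ _)
  have k1 : ∀ y : ZMod (q ^ n), IsUnit (t * y - (c : ZMod (q ^ n))) := by
    intro y
    have := key y (-c)
    rwa [Units.val_neg, ← sub_eq_add_neg] at this
  have k2 : ∀ y : ZMod (q ^ n),
      IsUnit (t * y * (t * y - (c : ZMod (q ^ n))) + (e : ZMod (q ^ n))) := by
    intro y
    rw [mul_assoc]
    exact key _ e
  refine ⟨fun v => ⟨k1 v, k2 v⟩, ?_⟩
  have hm : Set.MapsTo δ {x : ZMod (q ^ n) | IsUnit x} {x : ZMod (q ^ n) | IsUnit x} := by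
    intro x hx
    have hx' : IsUnit x := hx
    show IsUnit (δ x)
    rw [hδ]
    refine (hx'.neg.mul (k1 x)).mul ?_
    exact IsUnit.of_mul_eq_one _ (ZMod.inv_mul_of_unit _ (k2 x))
  refine ((Set.toFinite _).injOn_iff_bijOn_of_mapsTo hm).1 ?_
  intro x _ y _ h
  rw [hδ, hδ] at h
  have hx := ZMod.inv_mul_of_unit _ (k2 x)
  have hy := ZMod.inv_mul_of_unit _ (k2 y)
  generalize (t * x * (t * x - (c : ZMod (q ^ n))) + (e : ZMod (q ^ n)))⁻¹ = a at *
  generalize (t * y * (t * y - (c : ZMod (q ^ n))) + (e : ZMod (q ^ n)))⁻¹ = b at *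
  have h3 : x * (t * x - (c : ZMod (q ^ n))) *
        (t * y * (t * y - (c : ZMod (q ^ n))) + (e : ZMod (q ^ n))) =
      y * (t * y - (c : ZMod (q ^ n))) *
        (t * x * (t * x - (c : ZMod (q ^ n))) + (e : ZMod (q ^ n))) := by
    generalize hX : t * x * (t * x - (c : ZMod (q ^ n))) + (e : ZMod (q ^ n)) = X at *
    generalize hY : t * y * (t * y - (c : ZMod (q ^ n))) + (e : ZMod (q ^ n)) = Y at *
    linear_combination (-X * Y) * h - x * (t * x - c) * Y * hx + y * (t * y - c) * X * hy
  have h4 : ((e : ZMod (q ^ n)) * (t * (x + y) - c)) * (x - y) = 0 := by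
    linear_combination h3
  exact sub_eq_zero.1 (((e.isUnit.mul (k1 (x + y))).mul_right_eq_zero).1 h4)
end
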